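/- arXiv:1410.3559 — 5 statements merged into one kernel-verified Lean document; each statement's English description precedes it below -/
import Mathlib

section
/- Let Ω ⊆ ℂⁿ be a pseudoconvex domain (nonempty, open, connected, admitting a smooth plurisubharmonic exhaustion function), and let (Ω_j)_{j≥1} be open subsets of Ω with Ω_j ⊆ Ω_{j+1}, the closure of each Ω_j a compact subset of Ω, and ⋃_j Ω_j = Ω. Suppose there is a constant C > 0 such that for every j and every α ∈ (L²(Ω_j))ⁿ that is ∂̄-closed on Ω_j, there exists v ∈ L²(Ω_j) with ∂̄v = α distributionally on Ω_j, v orthogonal in L²(Ω_j) to every h ∈ L²(Ω_j) with ∂̄h = 0 distributionally on Ω_j, and ‖v‖_{L²(Ω_j)} ≤ C‖α‖_{(L²(Ω_j))ⁿ}. Then ∂̄ has closed range on Ω: the set R(∂̄) = {α ∈ (L²(Ω))ⁿ : ∃u ∈ L²(Ω) with ∂̄u = α distributionally on Ω} is closed in (L²(Ω))ⁿ; indeed ‖u‖_{L²(Ω)} ≤ C‖∂̄u‖ for every u ∈ D(∂̄) orthogonal to N(∂̄). -/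
open MeasureTheory Complex Metric Set

noncomputable section

/-- The Wirtinger derivative `∂φ/∂z̄_j` of `φ : ℂⁿ → ℂ`:
`(1/2)(Dφ_z(e_j) + i·Dφ_z(i·e_j))`. -/
def dbarCoord (n : ℕ) (φ : (Fin n → ℂ) → ℂ) (j : Fin n) (z : Fin n → ℂ) : ℂ :=
  (1 / 2) * (fderiv ℝ φ z (Pi.single j 1) + Complex.I * fderiv ℝ φ z (Pi.single j Complex.I))

/-- A test function on `Ω`: smooth with compact support contained in `Ω`. -/
def IsTest (n : ℕ) (Ω : Set (Fin n → ℂ)) (φ : (Fin n → ℂ) → ℂ) : Prop :=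
  ContDiff ℝ (⊤ : ℕ∞) φ ∧ HasCompactSupport φ ∧ tsupport φ ⊆ Ω

/-- `∂̄u = α` distributionally on `Ω`. -/
def DbarEq (n : ℕ) (Ω : Set (Fin n → ℂ)) (u : (Fin n → ℂ) → ℂ)
    (α : Fin n → (Fin n → ℂ) → ℂ) : Prop :=
  ∀ j : Fin n, ∀ φ : (Fin n → ℂ) → ℂ, IsTest n Ω φ →
    ∫ z in Ω, α j z * φ z = - ∫ z in Ω, u z * dbarCoord n φ j z

/-- `α` is `∂̄`-closed on `Ω`. -/
def DbarClosed (n : ℕ) (Ω : Set (Fin n → ℂ)) (α : Fin n → (Fin n → ℂ) → ℂ) : Prop :=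
  ∀ j k : Fin n, ∀ φ : (Fin n → ℂ) → ℂ, IsTest n Ω φ →
    ∫ z in Ω, α j z * dbarCoord n φ k z = ∫ z in Ω, α k z * dbarCoord n φ j z

/-- The complex Hessian `Hf(z;ξ) = (1/4)(D²f_z(ξ,ξ) + D²f_z(iξ,iξ))`. -/
def hessC (n : ℕ) (f : (Fin n → ℂ) → ℝ) (z ξ : Fin n → ℂ) : ℝ :=
  (1 / 4) * (iteratedFDeriv ℝ 2 f z ![ξ, ξ]
    + iteratedFDeriv ℝ 2 f z ![Complex.I • ξ, Complex.I • ξ])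

/-- The pairing `⟨∂f(z), ξ⟩ = (1/2)(Df_z(ξ) − i·Df_z(iξ))`. -/
def delPair (n : ℕ) (f : (Fin n → ℂ) → ℝ) (z ξ : Fin n → ℂ) : ℂ :=
  (1 / 2) * ((fderiv ℝ f z ξ : ℂ) - Complex.I * (fderiv ℝ f z (Complex.I • ξ) : ℂ))

/-- Squared Euclidean norm of `ξ ∈ ℂⁿ`. -/
def enormSq (n : ℕ) (ξ : Fin n → ℂ) : ℝ := ∑ j, Complex.normSq (ξ j)

/-- The twisted curvature expression
`Θ_{λ,τ}(z;ξ) = τ(z)·Hλ(z;ξ) − Hτ(z;ξ) − τ(z)⁻¹·|⟨∂τ(z),ξ⟩|²`. -/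
def Theta (n : ℕ) (lam tau : (Fin n → ℂ) → ℝ) (z ξ : Fin n → ℂ) : ℝ :=
  tau z * hessC n lam z ξ - hessC n tau z ξ - (tau z)⁻¹ * Complex.normSq (delPair n tau z ξ)

/-- `Φ` is an exhaustion function of `Ω`: every sublevel set has compact closure inside `Ω`. -/
def ExhaustsOn (n : ℕ) (Ω : Set (Fin n → ℂ)) (Φ : (Fin n → ℂ) → ℝ) : Prop :=
  ∀ c : ℝ, IsCompact (closure {z ∈ Ω | Φ z < c}) ∧ closure {z ∈ Ω | Φ z < c} ⊆ Ω

/-- `Ω` is pseudoconvex: it admits a smooth plurisubharmonic exhaustion function. -/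
def Pseudoconvex (n : ℕ) (Ω : Set (Fin n → ℂ)) : Prop :=
  ∃ Φ : (Fin n → ℂ) → ℝ, ContDiffOn ℝ (⊤ : ℕ∞) Φ Ω ∧ (∀ z ∈ Ω, ∀ ξ, 0 ≤ hessC n Φ z ξ) ∧
    ExhaustsOn n Ω Φ

/-- `r` is a smooth defining function for `Ω` which is Levi pseudoconvex. -/
def IsLeviDefiningFn (n : ℕ) (Ω : Set (Fin n → ℂ)) (r : (Fin n → ℂ) → ℝ) : Prop :=
  ContDiff ℝ (⊤ : ℕ∞) r ∧ Ω = {z | r z < 0} ∧ (∀ z, r z = 0 → fderiv ℝ r z ≠ 0) ∧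
    (∀ p, r p = 0 → ∀ ξ, delPair n r p ξ = 0 → 0 ≤ hessC n r p ξ)

/-! ### Test functions -/

lemma support_dbarCoord_subset {n : ℕ} (φ : (Fin n → ℂ) → ℂ) (j : Fin n) :
    Function.support (dbarCoord n φ j) ⊆ tsupport φ := by
  intro z hz
  by_contra h
  have h0 : fderiv ℝ φ z = 0 := by
    by_contra h1
    exact h (support_fderiv_subset ℝ h1)
  exact hz (by simp [dbarCoord, h0])

lemma IsTest.dbarCoord {n : ℕ} {Ω : Set (Fin n → ℂ)} {φ : (Fin n → ℂ) → ℂ}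
    (hφ : IsTest n Ω φ) (j : Fin n) : IsTest n Ω (dbarCoord n φ j) := by
  obtain ⟨h1, h2, h3⟩ := hφ
  have hsub : tsupport (_root_.dbarCoord n φ j) ⊆ tsupport φ :=
    closure_minimal (support_dbarCoord_subset φ j) (isClosed_tsupport φ)
  have hd : ContDiff ℝ (⊤ : ℕ∞) (fderiv ℝ φ) := h1.fderiv_right (by simp)
  refine ⟨?_, h2.of_isClosed_subset (isClosed_tsupport _) hsub, hsub.trans h3⟩
  unfold _root_.dbarCoord
  fun_prop

lemma IsTest.mono {n : ℕ} {U Ω : Set (Fin n → ℂ)} {φ : (Fin n → ℂ) → ℂ}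
    (hφ : IsTest n U φ) (h : U ⊆ Ω) : IsTest n Ω φ :=
  ⟨hφ.1, hφ.2.1, hφ.2.2.trans h⟩

lemma fderiv_dbarCoord_apply {n : ℕ} {φ : (Fin n → ℂ) → ℂ} (hφ : ContDiff ℝ (⊤ : ℕ∞) φ)
    (j : Fin n) (z c : Fin n → ℂ) :
    fderiv ℝ (dbarCoord n φ j) z c =
      (1 / 2) * (fderiv ℝ (fderiv ℝ φ) z c (Pi.single j 1)
        + Complex.I * fderiv ℝ (fderiv ℝ φ) z c (Pi.single j Complex.I)) := by
  have hd : ContDiff ℝ (⊤ : ℕ∞) (fderiv ℝ φ) := hφ.fderiv_right (by simp)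
  have hD := (hd.differentiable (by simp) z).hasFDerivAt
  have hev (a : Fin n → ℂ) : HasFDerivAt (fun y => fderiv ℝ φ y a)
      ((fderiv ℝ (fderiv ℝ φ) z).flip a) z := by
    simpa using hD.clm_apply (hasFDerivAt_const a z)
  have h := ((hev (Pi.single j 1)).add
    ((hev (Pi.single j Complex.I)).const_mul Complex.I)).const_mul (1 / 2 : ℂ)
  have h' : HasFDerivAt (dbarCoord n φ j) _ z := h
  rw [h'.fderiv]
  simp [mul_add]

lemma dbarCoord_comm {n : ℕ} {φ : (Fin n → ℂ) → ℂ} (hφ : ContDiff ℝ (⊤ : ℕ∞) φ)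
    (j k : Fin n) :
    dbarCoord n (dbarCoord n φ j) k = dbarCoord n (dbarCoord n φ k) j := by
  funext z
  have hs : IsSymmSndFDerivAt ℝ φ z :=
    hφ.contDiffAt.isSymmSndFDerivAt (by simpa using WithTop.coe_le_coe.2 (le_top : (2 : ℕ∞) ≤ ⊤))
  rw [dbarCoord, dbarCoord]
  simp only [fderiv_dbarCoord_apply hφ]
  rw [hs.eq (Pi.single k 1) (Pi.single j 1), hs.eq (Pi.single k 1) (Pi.single j Complex.I),
    hs.eq (Pi.single k Complex.I) (Pi.single j 1),
    hs.eq (Pi.single k Complex.I) (Pi.single j Complex.I)]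
  ring

lemma IsTest.memLp {n : ℕ} {Ω : Set (Fin n → ℂ)} {φ : (Fin n → ℂ) → ℂ}
    (hφ : IsTest n Ω φ) : MemLp φ 2 ((volume : Measure (Fin n → ℂ)).restrict Ω) :=
  (hφ.1.continuous.memLp_of_hasCompactSupport hφ.2.1).restrict Ω

lemma IsTest.setIntegral_mul_eq {n : ℕ} {U Ω : Set (Fin n → ℂ)} (hU : U ⊆ Ω)
    {φ : (Fin n → ℂ) → ℂ} (hφ : IsTest n U φ) (f : (Fin n → ℂ) → ℂ) :
    ∫ z in U, f z * φ z = ∫ z in Ω, f z * φ z := by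
  have key (V : Set (Fin n → ℂ)) (hV : U ⊆ V) : ∫ z in V, f z * φ z = ∫ z, f z * φ z := by
    refine setIntegral_eq_integral_of_forall_compl_eq_zero fun z hz => ?_
    rw [image_eq_zero_of_notMem_tsupport fun h => hz (hV (hφ.2.2 h)), mul_zero]
  rw [key U subset_rfl, key Ω hU]

/-- A compactly supported test function is supported in some member of an open exhaustion. -/
lemma IsTest.exists_of_iUnion {n : ℕ} {Ω : Set (Fin n → ℂ)} {Ω' : ℕ → Set (Fin n → ℂ)}
    (hopen : ∀ j, IsOpen (Ω' j)) (hmono : Monotone Ω') (hunion : (⋃ j, Ω' j) = Ω)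
    {φ : (Fin n → ℂ) → ℂ} (hφ : IsTest n Ω φ) : ∃ N, ∀ j, N ≤ j → IsTest n (Ω' j) φ := by
  obtain ⟨N, hN⟩ := hφ.2.1.elim_directed_cover Ω' hopen (by rw [hunion]; exact hφ.2.2)
    hmono.directed_le
  exact ⟨N, fun j hj => ⟨hφ.1, hφ.2.1, hN.trans (hmono hj)⟩⟩

/-! ### Pairings in `L²` -/

section Pairing

variable {X : Type*} [MeasurableSpace X] {μ : Measure X}

/-- Integration against an `L²` function is an inner product. -/
lemma MeasureTheory.MemLp.exists_integral_mul_eq_inner {f : X → ℂ} (hf : MemLp f 2 μ) :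
    ∃ g : Lp ℂ 2 μ, ∀ u : Lp ℂ 2 μ, ∫ x, u x * f x ∂μ = inner ℂ g u := by
  have hs : MemLp (fun x => (starRingEnd ℂ) (f x)) 2 μ := hf.star
  refine ⟨hs.toLp _, fun u => ?_⟩
  rw [L2.inner_def]
  refine integral_congr_ae ?_
  filter_upwards [hs.coeFn_toLp] with x hx
  rw [hx]
  simp

lemma MeasureTheory.MemLp.continuous_integral_mul {f : X → ℂ} (hf : MemLp f 2 μ) :
    Continuous fun u : Lp ℂ 2 μ => ∫ x, u x * f x ∂μ := by
  obtain ⟨g, hg⟩ := hf.exists_integral_mul_eq_inner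
  simp only [hg]
  fun_prop

/-- The restriction of an `L²` function to a subset. -/
lemma MeasureTheory.Lp.exists_restrict {U Ω : Set X} (hU : U ⊆ Ω)
    (u : Lp ℂ 2 (μ.restrict Ω)) :
    ∃ v : Lp ℂ 2 (μ.restrict U), v =ᵐ[μ.restrict U] u ∧ ‖v‖ ≤ ‖u‖ := by
  have hle : μ.restrict U ≤ μ.restrict Ω := Measure.restrict_mono hU le_rfl
  have hm : MemLp u 2 (μ.restrict U) := (Lp.memLp u).mono_measure hle
  refine ⟨hm.toLp _, hm.coeFn_toLp, ?_⟩
  rw [Lp.norm_toLp, Lp.norm_def]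
  exact ENNReal.toReal_mono (Lp.eLpNorm_ne_top u) (eLpNorm_mono_measure _ hle)

/-- The extension by zero of an `L²` function on a measurable subset. -/
lemma MeasureTheory.Lp.exists_extend {U Ω : Set X} (hU : U ⊆ Ω) (hUm : MeasurableSet U)
    (v : Lp ℂ 2 (μ.restrict U)) :
    ∃ u : Lp ℂ 2 (μ.restrict Ω), u =ᵐ[μ.restrict U] v ∧ ‖u‖ = ‖v‖ := by
  have hr : (μ.restrict Ω).restrict U = μ.restrict U := Measure.restrict_restrict_of_subset hU
  have hm : MemLp (U.indicator v) 2 (μ.restrict Ω) := by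
    rw [memLp_indicator_iff_restrict hUm, hr]
    exact Lp.memLp v
  refine ⟨hm.toLp _, ?_, ?_⟩
  · have h1 := ae_restrict_of_ae (s := U) hm.coeFn_toLp
    rw [hr] at h1
    filter_upwards [h1, ae_restrict_mem hUm] with x hx hxU
    rw [hx, indicator_of_mem hxU]
  · rw [Lp.norm_toLp, Lp.norm_def, eLpNorm_indicator_eq_eLpNorm_restrict hUm, hr]

end Pairing

/-- A bounded sequence in a Hilbert space converges weakly along an ultrafilter. -/
lemma exists_weak_limit_of_norm_le {H : Type*} [NormedAddCommGroup H] [InnerProductSpace ℂ H]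
    [CompleteSpace H] {x : ℕ → H} {M : ℝ} (hx : ∀ j, ‖x j‖ ≤ M) :
    ∃ y : H, ‖y‖ ≤ M ∧ ∀ h : H, Filter.Tendsto (fun j => inner ℂ h (x j))
      (Filter.hyperfilter ℕ) (nhds (inner ℂ h y)) := by
  have hK := WeakDual.isCompact_closedBall (𝕜 := ℂ) (0 : StrongDual ℂ H) M
  let T : ℕ → WeakDual ℂ H :=
    fun j => StrongDual.toWeakDual (InnerProductSpace.toDual ℂ H (x j))
  obtain ⟨L, hL, hlim⟩ := hK.ultrafilter_le_nhds ((Filter.hyperfilter ℕ).map T)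
    (Filter.le_principal_iff.2 (Filter.mem_map.2
      (Filter.Eventually.of_forall fun j => by simpa [T] using hx j)))
  refine ⟨(InnerProductSpace.toDual ℂ H).symm (WeakDual.toStrongDual L), by simpa using hL,
    fun h => ?_⟩
  have h1 : Filter.Tendsto (fun j => T j h) (Filter.hyperfilter ℕ) (nhds (L h)) :=
    ((WeakDual.eval_continuous h).tendsto L).comp hlim
  have h2 := (Complex.continuous_conj.tendsto _).comp h1
  rw [← inner_conj_symm, InnerProductSpace.toDual_symm_apply]
  refine h2.congr fun j => ?_
  simp [T]

/-! ### The `∂̄` operator -/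

lemma DbarEq.congr_left {n : ℕ} {Ω : Set (Fin n → ℂ)} {u v : (Fin n → ℂ) → ℂ}
    {α : Fin n → (Fin n → ℂ) → ℂ} (h : DbarEq n Ω u α)
    (huv : u =ᵐ[volume.restrict Ω] v) : DbarEq n Ω v α := by
  intro j φ hφ
  rw [h j φ hφ]
  congr 1
  refine integral_congr_ae ?_
  filter_upwards [huv] with z hz
  rw [hz]

lemma DbarEq.dbarClosed {n : ℕ} {Ω : Set (Fin n → ℂ)} {u : (Fin n → ℂ) → ℂ}
    {α : Fin n → (Fin n → ℂ) → ℂ} (h : DbarEq n Ω u α) : DbarClosed n Ω α := by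
  intro j k φ hφ
  rw [h j _ (hφ.dbarCoord k), h k _ (hφ.dbarCoord j), dbarCoord_comm hφ.1 k j]

lemma DbarEq.sub {n : ℕ} {Ω : Set (Fin n → ℂ)}
    {u v : Lp ℂ 2 ((volume : Measure (Fin n → ℂ)).restrict Ω)}
    {α : Fin n → (Fin n → ℂ) → ℂ} (hu : DbarEq n Ω u α) (hv : DbarEq n Ω v α) :
    DbarEq n Ω (⇑(u - v)) (fun _ _ => 0) := by
  intro j φ hφ
  obtain ⟨g, hg⟩ := (hφ.dbarCoord j).memLp.exists_integral_mul_eq_inner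
  have huv := (hu j φ hφ).symm.trans (hv j φ hφ)
  rw [hg, hg, neg_inj] at huv
  rw [hg, inner_sub_right, huv]
  simp

lemma isClosed_setOf_dbarClosed {n : ℕ} (Ω : Set (Fin n → ℂ)) :
    IsClosed {α : Fin n → Lp ℂ 2 ((volume : Measure (Fin n → ℂ)).restrict Ω) |
      DbarClosed n Ω (fun k => ⇑(α k))} := by
  simp only [DbarClosed, ofPred_forall]
  refine isClosed_iInter fun j => isClosed_iInter fun k => isClosed_iInter fun φ =>
    isClosed_iInter fun hφ => isClosed_eq ?_ ?_
  · exact (hφ.dbarCoord k).memLp.continuous_integral_mul.comp (continuous_apply j)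
  · exact (hφ.dbarCoord j).memLp.continuous_integral_mul.comp (continuous_apply k)

/-- Uniformly bounded solutions of `∂̄v = α` on an open exhaustion of `Ω` yield a solution on `Ω`
with the same bound. -/
lemma exists_dbarEq_of_exhaustion {n : ℕ} {Ω : Set (Fin n → ℂ)} {Ω' : ℕ → Set (Fin n → ℂ)}
    (hopen : ∀ j, IsOpen (Ω' j)) (hmono : Monotone Ω') (hunion : (⋃ j, Ω' j) = Ω)
    {α : Fin n → (Fin n → ℂ) → ℂ} {M : ℝ}
    (hsolve : ∀ j, ∃ v : Lp ℂ 2 ((volume : Measure (Fin n → ℂ)).restrict (Ω' j)),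
      DbarEq n (Ω' j) v α ∧ ‖v‖ ≤ M) :
    ∃ v : Lp ℂ 2 ((volume : Measure (Fin n → ℂ)).restrict Ω), DbarEq n Ω v α ∧ ‖v‖ ≤ M := by
  have hsub (j : ℕ) : Ω' j ⊆ Ω := hunion ▸ subset_iUnion Ω' j
  have hext (j : ℕ) : ∃ w : Lp ℂ 2 ((volume : Measure (Fin n → ℂ)).restrict Ω),
      DbarEq n (Ω' j) w α ∧ ‖w‖ ≤ M := by
    obtain ⟨v, hv, hvM⟩ := hsolve j
    obtain ⟨w, hw, hwn⟩ := Lp.exists_extend (hsub j) (hopen j).measurableSet v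
    exact ⟨w, hv.congr_left hw.symm, hwn.trans_le hvM⟩
  choose w hw hwM using hext
  obtain ⟨y, hyM, hy⟩ := exists_weak_limit_of_norm_le hwM
  refine ⟨y, fun k φ hφ => ?_, hyM⟩
  obtain ⟨g, hg⟩ := (hφ.dbarCoord k).memLp.exists_integral_mul_eq_inner
  obtain ⟨N, hN⟩ := hφ.exists_of_iUnion hopen hmono hunion
  rw [hg]
  refine tendsto_nhds_unique (Filter.Tendsto.congr' ?_ tendsto_const_nhds) (hy g).neg
  have hlarge : ∀ᶠ j in (Filter.hyperfilter ℕ : Filter ℕ), N ≤ j :=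
    Nat.hyperfilter_le_atTop (Filter.eventually_ge_atTop N)
  filter_upwards [hlarge] with j hj
  have hφj := hN j hj
  rw [← hg, ← (hφj.dbarCoord k).setIntegral_mul_eq (hsub j), ← hw j k φ hφj,
    hφj.setIntegral_mul_eq (hsub j)]

/-- **Approximation lemma for closed range (q = 0).** Let `Ω ⊆ ℂⁿ` be a pseudoconvex domain
exhausted by open subsets `Ω_j ⊆ Ω_{j+1}` with compact closures in `Ω`. If there is a
uniform constant `C > 0` such that on each `Ω_j` every `∂̄`-closed `α ∈ (L²(Ω_j))ⁿ` admits a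
solution `v ⊥ N(∂̄)` of `∂̄v = α` with `‖v‖ ≤ C‖α‖`, then `∂̄` has closed range on `Ω`;
indeed `‖u‖ ≤ C‖∂̄u‖` for every `u ∈ D(∂̄)` orthogonal to `N(∂̄)`. -/
theorem closed_range_of_uniform_estimates_on_exhaustion
    {n : ℕ} (Ω : Set (Fin n → ℂ)) (hne : Ω.Nonempty) (hop : IsOpen Ω)
    (hconn : IsConnected Ω) (hpsc : Pseudoconvex n Ω)
    (Ω' : ℕ → Set (Fin n → ℂ))
    (hopj : ∀ j, IsOpen (Ω' j))
    (hsub : ∀ j, Ω' j ⊆ Ω' (j + 1))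
    (hcpt : ∀ j, IsCompact (closure (Ω' j)) ∧ closure (Ω' j) ⊆ Ω)
    (hunion : (⋃ j, Ω' j) = Ω)
    (C : ℝ) (hC : 0 < C)
    (hsolve : ∀ j : ℕ,
      ∀ α : Fin n → Lp ℂ 2 ((volume : Measure (Fin n → ℂ)).restrict (Ω' j)),
      DbarClosed n (Ω' j) (fun k => ⇑(α k)) →
      ∃ v : Lp ℂ 2 ((volume : Measure (Fin n → ℂ)).restrict (Ω' j)),
        DbarEq n (Ω' j) (⇑v) (fun k => ⇑(α k)) ∧
        (∀ h : Lp ℂ 2 ((volume : Measure (Fin n → ℂ)).restrict (Ω' j)),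
          DbarEq n (Ω' j) (⇑h) (fun _ _ => 0) → @inner ℂ _ _ v h = 0) ∧
        ‖v‖ ≤ C * Real.sqrt (∑ k, ‖α k‖ ^ 2)) :
    IsClosed {α : Fin n → Lp ℂ 2 ((volume : Measure (Fin n → ℂ)).restrict Ω) |
      ∃ u : Lp ℂ 2 ((volume : Measure (Fin n → ℂ)).restrict Ω),
        DbarEq n Ω (⇑u) (fun j => ⇑(α j))} ∧
    (∀ u : Lp ℂ 2 ((volume : Measure (Fin n → ℂ)).restrict Ω),
      ∀ β : Fin n → Lp ℂ 2 ((volume : Measure (Fin n → ℂ)).restrict Ω),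
      DbarEq n Ω (⇑u) (fun j => ⇑(β j)) →
      (∀ h : Lp ℂ 2 ((volume : Measure (Fin n → ℂ)).restrict Ω),
        DbarEq n Ω (⇑h) (fun _ _ => 0) → @inner ℂ _ _ u h = 0) →
      ‖u‖ ≤ C * Real.sqrt (∑ j, ‖β j‖ ^ 2)) := by
  have hmono : Monotone Ω' := monotone_nat_of_le_succ hsub
  have hsubΩ (j : ℕ) : Ω' j ⊆ Ω := hunion ▸ subset_iUnion Ω' j
  have hexists (α : Fin n → Lp ℂ 2 ((volume : Measure (Fin n → ℂ)).restrict Ω))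
      (hα : DbarClosed n Ω (fun k => ⇑(α k))) :
      ∃ v : Lp ℂ 2 ((volume : Measure (Fin n → ℂ)).restrict Ω),
        DbarEq n Ω v (fun k => ⇑(α k)) ∧ ‖v‖ ≤ C * Real.sqrt (∑ k, ‖α k‖ ^ 2) := by
    refine exists_dbarEq_of_exhaustion hopj hmono hunion fun j => ?_
    choose β hβ hβn using fun k => Lp.exists_restrict (hsubΩ j) (α k)
    have hβint (k : Fin n) (φ : (Fin n → ℂ) → ℂ) :
        ∫ z in Ω' j, β k z * φ z = ∫ z in Ω' j, α k z * φ z := by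
      refine integral_congr_ae ?_
      filter_upwards [hβ k] with z hz
      rw [hz]
    obtain ⟨v, hv, -, hvn⟩ := hsolve j β fun k l φ hφ => by
      rw [hβint, hβint, (hφ.dbarCoord l).setIntegral_mul_eq (hsubΩ j),
        (hφ.dbarCoord k).setIntegral_mul_eq (hsubΩ j)]
      exact hα k l φ (hφ.mono (hsubΩ j))
    refine ⟨v, fun k φ hφ => by rw [← hv k φ hφ, hβint], hvn.trans ?_⟩
    gcongr with k
    exact hβn k
  refine ⟨?_, fun u β hu horth => ?_⟩
  · convert isClosed_setOf_dbarClosed Ω using 1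
    ext α
    exact ⟨fun ⟨u, hu⟩ => hu.dbarClosed, fun hα => (hexists α hα).imp fun v hv => hv.1⟩
  · obtain ⟨v, hv, hvn⟩ := hexists β hu.dbarClosed
    refine le_trans ?_ hvn
    have h0 := horth (u - v) (hu.sub hv)
    rw [inner_sub_right, sub_eq_zero] at h0
    have h1 : ‖u‖ * ‖u‖ ≤ ‖u‖ * ‖v‖ := by
      rw [← inner_self_eq_norm_mul_norm (𝕜 := ℂ) u, h0]
      exact re_inner_le_norm u v
    rcases (norm_nonneg u).eq_or_lt with h | h
    · rw [← h]
      exact norm_nonneg v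
    · exact le_of_mul_le_mul_left h1 h
end
end

section
/- Let Ω ⊆ ℂ be a nonempty open connected set satisfying condition 𝒳. Then ∂̄ has closed range on L²_{0,1}(Ω): the set R(∂̄) = {f ∈ L²(Ω) : ∃u ∈ L²(Ω) with ∂̄u = f distributionally on Ω} is closed in L²(Ω). -/
open MeasureTheory Complex Metric Set

noncomputable section

/-- The Wirtinger derivative `∂φ/∂z̄(z) = (1/2)(Dφ_z(1) + i·Dφ_z(i))` of `φ : ℂ → ℂ`. -/
def dbar1 (φ : ℂ → ℂ) (z : ℂ) : ℂ :=
  (1 / 2) * (fderiv ℝ φ z 1 + Complex.I * fderiv ℝ φ z Complex.I)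

/-- A test function on `Ω ⊆ ℂ`: smooth with compact support contained in `Ω`. -/
def IsTest1 (Ω : Set ℂ) (φ : ℂ → ℂ) : Prop :=
  ContDiff ℝ (⊤ : ℕ∞) φ ∧ HasCompactSupport φ ∧ tsupport φ ⊆ Ω

/-- `∂̄u = f` distributionally on `Ω ⊆ ℂ`. -/
def DbarEq1 (Ω : Set ℂ) (u f : ℂ → ℂ) : Prop :=
  ∀ φ : ℂ → ℂ, IsTest1 Ω φ → ∫ z in Ω, f z * φ z = - ∫ z in Ω, u z * dbar1 φ z

/-- Condition `𝒳` with constants `M, δ`: every `z ∈ Ω` has a point `w` with `|w − z| < M`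
outside `closure Ω` whose distance to `closure Ω` exceeds `δ`. -/
def CondXWith (Ω : Set ℂ) (M δ : ℝ) : Prop :=
  ∀ z ∈ Ω, ∃ w : ℂ, dist w z < M ∧ w ∉ closure Ω ∧ δ < Metric.infDist w (closure Ω)

/-- Condition `𝒳`. -/
def CondX (Ω : Set ℂ) : Prop := ∃ M > 0, ∃ δ > 0, CondXWith Ω M δ

/-- One quarter of the Laplacian, `φ_{zz̄}(z) = (1/4)(D²φ_z(1,1) + D²φ_z(i,i))`. -/
def lapQuarter (φ : ℂ → ℝ) (z : ℂ) : ℝ :=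
  (1 / 4) * (iteratedFDeriv ℝ 2 φ z ![1, 1]
    + iteratedFDeriv ℝ 2 φ z ![Complex.I, Complex.I])


open scoped RealInnerProductSpace

/-- Integrating by parts twice: the mixed term `∫ ⟪φ_x, i φ_y⟫` vanishes. -/
theorem integral_inner_fderiv_I_mul_fderiv {φ : ℂ → ℂ} (hφ : ContDiff ℝ 2 φ)
    (hc : HasCompactSupport φ) :
    ∫ z, ⟪fderiv ℝ φ z 1, I * fderiv ℝ φ z I⟫ = 0 := by
  let B : ℂ →L[ℝ] ℂ →L[ℝ] ℝ :=
    ((innerSL ℝ (E := ℂ)).flip.comp (ContinuousLinearMap.mul ℝ ℂ I)).flip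
  have hB : ∀ a b, B a b = ⟪a, I * b⟫ := fun a b => by
    simp only [B, ContinuousLinearMap.flip_apply, ContinuousLinearMap.comp_apply,
      ContinuousLinearMap.mul_apply', innerSL_apply_apply]
  have hd : ContDiff ℝ 1 (fderiv ℝ φ) := hφ.fderiv_right (by norm_num)
  have hdv : ∀ v, ContDiff ℝ 1 (fun z => fderiv ℝ φ z v) := fun v => hd.clm_apply contDiff_const
  have hcd : HasCompactSupport (fderiv ℝ φ) := hc.fderiv ℝ
  have key : ∀ v w : ℂ, ∫ z, B (fderiv ℝ φ z v) (fderiv ℝ φ z w)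
      = - ∫ z, B (fderiv ℝ (fderiv ℝ φ) z w v) (φ z) := by
    intro v w
    have hf : ∀ z, fderiv ℝ (fun z => fderiv ℝ φ z v) z w = fderiv ℝ (fderiv ℝ φ) z w v := by
      intro z
      rw [fderiv_clm_apply (hd.differentiable one_ne_zero z) (by fun_prop)]
      simp
    simp_rw [← hf]
    have c1 : Continuous fun z => fderiv ℝ (fun z => fderiv ℝ φ z v) z w :=
      ((hdv v).continuous_fderiv one_ne_zero).clm_apply continuous_const
    have c2 := fun v => (hdv v).continuous
    have c3 := hφ.continuous
    refine integral_bilinear_fderiv_right_eq_neg_left_of_integrable ?_ ?_ ?_ ?_ ?_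
    · refine Continuous.integrable_of_hasCompactSupport (by fun_prop) (hc.mono ?_)
      intro z hz h; exact hz (by simp [h])
    · refine Continuous.integrable_of_hasCompactSupport ?_ (hcd.mono ?_)
      · have := c2 v
        have := c2 w
        fun_prop
      · intro z hz h; exact hz (by simp [h])
    · refine Continuous.integrable_of_hasCompactSupport ?_ (hc.mono ?_)
      · have := c2 v
        fun_prop
      · intro z hz h; exact hz (by simp [h])
    · exact fun z _ => (hdv v).differentiable one_ne_zero z
    · exact fun z _ => hφ.differentiable two_ne_zero z
  have hsymm : ∀ z, fderiv ℝ (fderiv ℝ φ) z I 1 = fderiv ℝ (fderiv ℝ φ) z 1 I := fun z =>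
    (hφ.contDiffAt.isSymmSndFDerivAt (by simp)).eq I 1
  have h1 := key 1 I
  have h2 := key I 1
  simp_rw [hsymm] at h1
  rw [← h2] at h1
  have h3 : ∀ z, B (fderiv ℝ φ z I) (fderiv ℝ φ z 1) = - B (fderiv ℝ φ z 1) (fderiv ℝ φ z I) := by
    intro z
    simp only [hB, Complex.inner, mul_re, mul_im, conj_re, conj_im, I_re, I_im]
    ring
  simp_rw [h3, integral_neg, hB] at h1
  linarith

/-- For compactly supported `φ`, the full gradient is controlled by `∂φ/∂z̄` in `L²`. -/
theorem integral_norm_sq_fderiv_eq_dbar1 {φ : ℂ → ℂ} (hφ : ContDiff ℝ 2 φ)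
    (hc : HasCompactSupport φ) :
    ∫ z, (‖fderiv ℝ φ z 1‖ ^ 2 + ‖fderiv ℝ φ z I‖ ^ 2) = 4 * ∫ z, ‖dbar1 φ z‖ ^ 2 := by
  have hcd : HasCompactSupport (fderiv ℝ φ) := hc.fderiv ℝ
  have c1 := fun v => (hφ.continuous_fderiv two_ne_zero).clm_apply (continuous_const (y := v))
  have h1 := c1 1
  have hI := c1 I
  have hpt : ∀ z, 4 * ‖dbar1 φ z‖ ^ 2 = (‖fderiv ℝ φ z 1‖ ^ 2 + ‖fderiv ℝ φ z I‖ ^ 2)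
      + 2 * ⟪fderiv ℝ φ z 1, I * fderiv ℝ φ z I⟫ := by
    intro z
    have : ‖dbar1 φ z‖ = (1 / 2) * ‖fderiv ℝ φ z 1 + I * fderiv ℝ φ z I‖ := by
      simp [dbar1]
    rw [this, mul_pow, norm_add_sq_real]
    simp
    ring
  rw [← integral_const_mul]
  simp_rw [hpt]
  rw [integral_add (f := fun z => ‖fderiv ℝ φ z 1‖ ^ 2 + ‖fderiv ℝ φ z I‖ ^ 2), integral_const_mul,
    integral_inner_fderiv_I_mul_fderiv hφ hc, mul_zero, add_zero]
  · refine Continuous.integrable_of_hasCompactSupport (by fun_prop) (hcd.mono ?_)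
    intro z hz h; exact hz (by simp [h])
  · refine Continuous.integrable_of_hasCompactSupport (by fun_prop) (hcd.mono ?_)
    intro z hz h; exact hz (by simp [h])

/-- Integration by parts in the direction `e` against the field `-(z - w) / (a + |z - w|²)²`. -/
theorem integral_weight_line_le {φ : ℂ → ℂ} (hφ : ContDiff ℝ 2 φ)
    (hc : HasCompactSupport φ) {a : ℝ} (ha : 0 < a) (w e : ℂ) (he : ‖e‖ = 1) :
    ∫ z, ‖φ z‖ ^ 2 * (4 * ⟪e, z - w⟫ ^ 2 / (a + ‖z - w‖ ^ 2) ^ 3 - 1 / (a + ‖z - w‖ ^ 2) ^ 2)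
      ≤ ∫ z, 2 * (‖φ z‖ * ‖fderiv ℝ φ z e‖) * (‖z - w‖ / (a + ‖z - w‖ ^ 2) ^ 2) := by
  have hq : ∀ z : ℂ, a + ‖z - w‖ ^ 2 ≠ 0 := fun z => by positivity
  have hq2 : ∀ z : ℂ, (a + ‖z - w‖ ^ 2) ^ 2 ≠ 0 := fun z => by positivity
  have hq3 : ∀ z : ℂ, (a + ‖z - w‖ ^ 2) ^ 3 ≠ 0 := fun z => by positivity
  have c0 := hφ.continuous
  have c1 := (hφ.continuous_fderiv two_ne_zero).clm_apply (continuous_const (y := e))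
  have hibp := integral_bilinear_hasLineDerivAt_right_eq_neg_left_of_integrable
    (μ := (volume : Measure ℂ)) (B := ContinuousLinearMap.mul ℝ ℝ) (v := e)
    (f := fun z => ‖φ z‖ ^ 2) (f' := fun z => 2 * ⟪φ z, fderiv ℝ φ z e⟫)
    (g := fun z => -⟪e, z - w⟫ / (a + ‖z - w‖ ^ 2) ^ 2)
    (g' := fun z =>
      4 * ⟪e, z - w⟫ ^ 2 / (a + ‖z - w‖ ^ 2) ^ 3 - 1 / (a + ‖z - w‖ ^ 2) ^ 2)
    ?_ ?_ ?_ ?_ ?_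
  · simp only [ContinuousLinearMap.mul_apply'] at hibp
    rw [hibp, ← integral_neg]
    refine integral_mono ?_ ?_ ?_
    · refine Continuous.integrable_of_hasCompactSupport (by fun_prop (disch := assumption))
        (hc.mono ?_)
      intro z hz h; exact hz (by simp [h])
    · refine Continuous.integrable_of_hasCompactSupport (by fun_prop (disch := assumption))
        (hc.mono ?_)
      intro z hz h; exact hz (by simp [h])
    · intro z
      have e1 := abs_real_inner_le_norm (φ z) (fderiv ℝ φ z e)
      have e2 := abs_real_inner_le_norm e (z - w)
      rw [he, one_mul] at e2
      have e3 : ⟪φ z, fderiv ℝ φ z e⟫ * ⟪e, z - w⟫ ≤ ‖φ z‖ * ‖fderiv ℝ φ z e‖ * ‖z - w‖ := by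
        refine (le_abs_self _).trans ?_
        rw [abs_mul]
        gcongr
      have e4 : 0 < (a + ‖z - w‖ ^ 2) ^ 2 := by positivity
      calc _ = 2 * (⟪φ z, fderiv ℝ φ z e⟫ * ⟪e, z - w⟫) / (a + ‖z - w‖ ^ 2) ^ 2 := by ring
        _ ≤ 2 * (‖φ z‖ * ‖fderiv ℝ φ z e‖ * ‖z - w‖) / (a + ‖z - w‖ ^ 2) ^ 2 := by gcongr
        _ = _ := by ring
  · refine Continuous.integrable_of_hasCompactSupport (by
      simp only [ContinuousLinearMap.mul_apply']; fun_prop (disch := assumption)) (hc.mono ?_)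
    intro z hz h; exact hz (by simp [h])
  · refine Continuous.integrable_of_hasCompactSupport (by
      simp only [ContinuousLinearMap.mul_apply']; fun_prop (disch := assumption)) (hc.mono ?_)
    intro z hz h; exact hz (by simp [h])
  · refine Continuous.integrable_of_hasCompactSupport (by
      simp only [ContinuousLinearMap.mul_apply']; fun_prop (disch := assumption)) (hc.mono ?_)
    intro z hz h; exact hz (by simp [h])
  · intro z _
    have := (hφ.differentiable two_ne_zero z).hasFDerivAt.norm_sq.hasLineDerivAt e
    simpa [mul_add] using this
  · intro z _
    have h0 : HasDerivAt (fun t : ℝ => z + t • e - w) e 0 := by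
      simpa using (((hasDerivAt_id (0 : ℝ)).smul_const e).const_add z).sub_const w
    have h1 := (hasDerivAt_const (0 : ℝ) e).inner ℝ h0
    have h2 := ((h0.norm_sq).const_add a).pow 2
    have h3 := h1.neg.div h2 (by simpa using hq2 z)
    unfold HasLineDerivAt
    refine h3.congr_deriv ?_
    simp [he, real_inner_comm e (z - w)]
    field_simp [hq z]
    ring

/-- A weighted inequality with a weight that is positive away from `w`. -/
theorem integral_weight_le {φ : ℂ → ℂ} (hφ : ContDiff ℝ 2 φ)
    (hc : HasCompactSupport φ) {a : ℝ} (ha : 0 < a) (w : ℂ) :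
    ∫ z, ‖φ z‖ ^ 2 * (2 * (‖z - w‖ ^ 2 - a) / (a + ‖z - w‖ ^ 2) ^ 3)
      ≤ ∫ z, 2 * (‖φ z‖ * (‖fderiv ℝ φ z 1‖ + ‖fderiv ℝ φ z I‖)) *
        (‖z - w‖ / (a + ‖z - w‖ ^ 2) ^ 2) := by
  have hq2 : ∀ z : ℂ, (a + ‖z - w‖ ^ 2) ^ 2 ≠ 0 := fun z => by positivity
  have hq3 : ∀ z : ℂ, (a + ‖z - w‖ ^ 2) ^ 3 ≠ 0 := fun z => by positivity
  have c0 := hφ.continuous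
  have c1 := fun e => (hφ.continuous_fderiv two_ne_zero).clm_apply (continuous_const (y := e))
  have hint1 : ∀ e : ℂ, Integrable fun z => ‖φ z‖ ^ 2 *
      (4 * ⟪e, z - w⟫ ^ 2 / (a + ‖z - w‖ ^ 2) ^ 3 - 1 / (a + ‖z - w‖ ^ 2) ^ 2) := fun e => by
    refine Continuous.integrable_of_hasCompactSupport (by fun_prop (disch := assumption))
      (hc.mono ?_)
    intro z hz h; exact hz (by simp [h])
  have hint2 : ∀ e : ℂ, Integrable fun z => 2 * (‖φ z‖ * ‖fderiv ℝ φ z e‖) *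
      (‖z - w‖ / (a + ‖z - w‖ ^ 2) ^ 2) := fun e => by
    have := c1 e
    refine Continuous.integrable_of_hasCompactSupport (by fun_prop (disch := assumption))
      (hc.mono ?_)
    intro z hz h; exact hz (by simp [h])
  have h := add_le_add (integral_weight_line_le hφ hc ha w 1 (by simp))
    (integral_weight_line_le hφ hc ha w I (by simp))
  rw [← integral_add (hint1 1) (hint1 I), ← integral_add (hint2 1) (hint2 I)] at h
  refine (le_of_eq (integral_congr_ae (.of_forall fun z => ?_))).trans
    (h.trans (le_of_eq (integral_congr_ae (.of_forall fun z => ?_))))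
  · have hn : ‖z - w‖ ^ 2 = ⟪(1 : ℂ), z - w⟫ ^ 2 + ⟪I, z - w⟫ ^ 2 := by
      rw [← Complex.normSq_eq_norm_sq, Complex.normSq_apply]
      simp [Complex.inner]
      ring
    have : a + ‖z - w‖ ^ 2 ≠ 0 := by positivity
    rw [← mul_add]
    congr 1
    field_simp
    linear_combination (4 : ℝ) * hn
  · ring

theorem integrable_norm_div_add_sq {a : ℝ} (ha : 0 < a) :
    Integrable fun ζ : ℂ => ‖ζ‖ / (a + ‖ζ‖ ^ 2) ^ 2 := by
  have hq2 : ∀ z : ℂ, (a + ‖z‖ ^ 2) ^ 2 ≠ 0 := fun z => by positivity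
  set m := min a 1 with hm
  have hm0 : 0 < m := lt_min ha one_pos
  have h := (integrable_one_add_norm (E := ℂ) (μ := volume) (r := 3)
    (by rw [Complex.finrank_real_complex]; norm_num)).const_mul (4 / m ^ 2)
  refine h.mono' (Continuous.aestronglyMeasurable (by fun_prop (disch := assumption)))
    (.of_forall fun ζ => ?_)
  have hn := norm_nonneg ζ
  set t := ‖ζ‖
  have e0 : (1 + t) ^ 2 ≤ 2 * (1 + t ^ 2) := by nlinarith [sq_nonneg (1 - t)]
  have e1 : m * (1 + t ^ 2) ≤ a + t ^ 2 := by
    have h1 : m ≤ a := min_le_left _ _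
    have h2 : m ≤ 1 := min_le_right _ _
    nlinarith [sq_nonneg t]
  have e2 : m / 2 * (1 + t) ^ 2 ≤ a + t ^ 2 := by nlinarith
  have e3 : (m / 2 * (1 + t) ^ 2) ^ 2 ≤ (a + t ^ 2) ^ 2 := by gcongr
  rw [Real.norm_of_nonneg (by positivity), Real.rpow_neg (by positivity)]
  have : (1 + t) ^ (3 : ℝ) = (1 + t) ^ 3 := by exact_mod_cast Real.rpow_natCast (1 + t) 3
  rw [this]
  calc t / (a + t ^ 2) ^ 2 ≤ (1 + t) / (m / 2 * (1 + t) ^ 2) ^ 2 := by gcongr; linarith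
    _ = _ := by field_simp; ring

/-- Averaging the weighted inequality over all `w` in a set `E` away from the support. -/
theorem mul_integral_norm_sq_le {φ : ℂ → ℂ} (hφ : ContDiff ℝ 2 φ) (hc : HasCompactSupport φ)
    {r M : ℝ} (hr : 0 < r) (hM : 0 < M) {E : Set ℂ} (hE : MeasurableSet E)
    (hfar : ∀ z, φ z ≠ 0 → ∀ w ∈ E, r ≤ ‖z - w‖)
    (hnear : ∀ z, φ z ≠ 0 → ∃ p, ‖z - p‖ < M ∧ ball p r ⊆ E) :
    (r ^ 2 / (r ^ 2 / 2 + (M + r) ^ 2) ^ 3 * volume.real (ball (0 : ℂ) r)) * ∫ z, ‖φ z‖ ^ 2 ≤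
      (∫ ζ : ℂ, ‖ζ‖ / (r ^ 2 / 2 + ‖ζ‖ ^ 2) ^ 2) *
        ∫ z, 2 * (‖φ z‖ * (‖fderiv ℝ φ z 1‖ + ‖fderiv ℝ φ z I‖)) := by
  have ha : 0 < r ^ 2 / 2 := by positivity
  set a := r ^ 2 / 2 with ha'
  set K : ℂ → ℝ := fun ζ => ‖ζ‖ / (a + ‖ζ‖ ^ 2) ^ 2 with hK
  set D : ℂ → ℝ := fun ζ => 2 * (‖ζ‖ ^ 2 - a) / (a + ‖ζ‖ ^ 2) ^ 3 with hD
  set P : ℂ → ℝ := fun z => 2 * (‖φ z‖ * (‖fderiv ℝ φ z 1‖ + ‖fderiv ℝ φ z I‖)) with hP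
  set d := r ^ 2 / (a + (M + r) ^ 2) ^ 3 with hd
  have hd0 : 0 < d := by positivity
  have hK0 : ∀ ζ, 0 ≤ K ζ := fun ζ => by positivity
  have hP0 : ∀ ζ, 0 ≤ P ζ := fun ζ => by positivity
  have hq2 : ∀ z : ℂ, (a + ‖z‖ ^ 2) ^ 2 ≠ 0 := fun z => by positivity
  have hq3 : ∀ z : ℂ, (a + ‖z‖ ^ 2) ^ 3 ≠ 0 := fun z => by positivity
  have cφ := hφ.continuous
  have cf := fun e => (hφ.continuous_fderiv two_ne_zero).clm_apply (continuous_const (y := e))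
  have cK : Continuous K := by fun_prop (disch := assumption)
  have cD : Continuous D := by fun_prop (disch := assumption)
  have cP : Continuous P := by have := cf 1; have := cf I; fun_prop
  have iK : Integrable K := integrable_norm_div_add_sq ha
  have iP : Integrable P := cP.integrable_of_hasCompactSupport
    (hc.mono fun z hz h => hz (by simp [hP, h]))
  have iN : Integrable fun z => ‖φ z‖ ^ 2 := Continuous.integrable_of_hasCompactSupport
    (by fun_prop) (hc.mono fun z hz h => hz (by simp [h]))
  have hslice : ∀ w ∈ E, ∫⁻ z, ENNReal.ofReal (‖φ z‖ ^ 2 * D (z - w)) ≤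
      ∫⁻ z, ENNReal.ofReal (P z * K (z - w)) := by
    intro w hw
    rw [← ofReal_integral_eq_lintegral_ofReal, ← ofReal_integral_eq_lintegral_ofReal]
    · exact ENNReal.ofReal_le_ofReal (integral_weight_le hφ hc ha w)
    · exact Continuous.integrable_of_hasCompactSupport (by fun_prop)
        (hc.mono fun z hz h => hz (by simp [hP, h]))
    · exact .of_forall fun z => mul_nonneg (hP0 _) (hK0 _)
    · exact Continuous.integrable_of_hasCompactSupport (by fun_prop)
        (hc.mono fun z hz h => hz (by simp [h]))
    · refine .of_forall fun z => ?_
      by_cases hz : φ z = 0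
      · simp [hz]
      · have h1 := hfar z hz w hw
        have h2 : a ≤ ‖z - w‖ ^ 2 := by nlinarith
        have h3 : 0 ≤ ‖z - w‖ ^ 2 - a := by linarith
        simp only [hD, Pi.zero_apply]
        positivity
  have hlow : ∀ z, ENNReal.ofReal (‖φ z‖ ^ 2) * (ENNReal.ofReal d * volume (ball (0 : ℂ) r)) ≤
      ∫⁻ w in E, ENNReal.ofReal (‖φ z‖ ^ 2 * D (z - w)) := by
    intro z
    by_cases hz : φ z = 0
    · simp [hz]
    obtain ⟨p, hp, hpE⟩ := hnear z hz
    have hvol : volume (ball (0 : ℂ) r) = volume (ball p r) :=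
      (Measure.addHaar_ball_center volume p r).symm
    rw [hvol, ← mul_assoc, ← ENNReal.ofReal_mul (by positivity), ← setLIntegral_const]
    refine (setLIntegral_mono' measurableSet_ball fun w hw => ?_).trans
      (lintegral_mono_set hpE)
    refine ENNReal.ofReal_le_ofReal (mul_le_mul_of_nonneg_left ?_ (by positivity))
    have h1 := hfar z hz w (hpE hw)
    have h2 : ‖z - w‖ ≤ M + r := by
      have : ‖z - w‖ ≤ ‖z - p‖ + ‖p - w‖ := norm_sub_le_norm_sub_add_norm_sub z p w
      rw [mem_ball, dist_comm, dist_eq_norm] at hw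
      linarith
    have h3 : r ^ 2 ≤ 2 * (‖z - w‖ ^ 2 - a) := by nlinarith
    have h4 : ‖z - w‖ ^ 2 ≤ (M + r) ^ 2 := by gcongr
    simp only [hD, hd]
    gcongr
    nlinarith
  have hmain : ENNReal.ofReal (∫ z, ‖φ z‖ ^ 2) * (ENNReal.ofReal d * volume (ball (0 : ℂ) r)) ≤
      ENNReal.ofReal (∫ z, P z) * ENNReal.ofReal (∫ ζ, K ζ) := by
    rw [ofReal_integral_eq_lintegral_ofReal iN (.of_forall fun z => by positivity),
      ofReal_integral_eq_lintegral_ofReal iP (.of_forall hP0),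
      ofReal_integral_eq_lintegral_ofReal iK (.of_forall hK0)]
    calc _ = ∫⁻ z, ENNReal.ofReal (‖φ z‖ ^ 2) * (ENNReal.ofReal d * volume (ball (0 : ℂ) r)) := by
          rw [lintegral_mul_const]
          fun_prop
      _ ≤ ∫⁻ z, ∫⁻ w in E, ENNReal.ofReal (‖φ z‖ ^ 2 * D (z - w)) := lintegral_mono hlow
      _ = ∫⁻ w in E, ∫⁻ z, ENNReal.ofReal (‖φ z‖ ^ 2 * D (z - w)) := by
          refine lintegral_lintegral_swap (Measurable.aemeasurable ?_)
          have : Continuous fun q : ℂ × ℂ => ‖φ q.1‖ ^ 2 * D (q.1 - q.2) := by fun_prop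
          exact (ENNReal.continuous_ofReal.comp this).measurable
      _ ≤ ∫⁻ w in E, ∫⁻ z, ENNReal.ofReal (P z * K (z - w)) := setLIntegral_mono' hE hslice
      _ ≤ ∫⁻ w, ∫⁻ z, ENNReal.ofReal (P z * K (z - w)) := setLIntegral_le_lintegral _ _
      _ = ∫⁻ z, ∫⁻ w, ENNReal.ofReal (P z * K (z - w)) := by
          refine (lintegral_lintegral_swap (Measurable.aemeasurable ?_)).symm
          have : Continuous fun q : ℂ × ℂ => P q.1 * K (q.1 - q.2) := by fun_prop
          exact (ENNReal.continuous_ofReal.comp this).measurable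
      _ = ∫⁻ z, ENNReal.ofReal (P z) * ∫⁻ ζ, ENNReal.ofReal (K ζ) := by
          refine lintegral_congr fun z => ?_
          simp_rw [ENNReal.ofReal_mul (hP0 z)]
          rw [lintegral_const_mul _ (by fun_prop),
            lintegral_sub_left_eq_self (fun ζ => ENNReal.ofReal (K ζ))]
      _ = _ := by
          rw [lintegral_mul_const]
          fun_prop
  have hv : volume (ball (0 : ℂ) r) = ENNReal.ofReal (volume.real (ball (0 : ℂ) r)) :=
    (ofReal_measureReal measure_ball_lt_top.ne).symm
  have hN0 : 0 ≤ ∫ z, ‖φ z‖ ^ 2 := integral_nonneg fun z => by positivity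
  have hIP0 : 0 ≤ ∫ z, P z := integral_nonneg hP0
  rw [hv, ← ENNReal.ofReal_mul hd0.le, ← ENNReal.ofReal_mul hN0, ← ENNReal.ofReal_mul hIP0,
    ENNReal.ofReal_le_ofReal_iff (mul_nonneg hIP0 (integral_nonneg hK0))] at hmain
  linarith

/-- The Poincaré-type inequality for `∂̄` on test functions implied by condition `𝒳`. -/
theorem CondX.exists_integral_norm_sq_le {Ω : Set ℂ} (hX : CondX Ω) :
    ∃ A : ℝ, 0 ≤ A ∧ ∀ φ, IsTest1 Ω φ → ∫ z, ‖φ z‖ ^ 2 ≤ A * ∫ z, ‖dbar1 φ z‖ ^ 2 := by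
  obtain ⟨M, hM, δ, hδ, h⟩ := hX
  have hr : 0 < δ / 2 := by positivity
  set r := δ / 2 with hr'
  set c := r ^ 2 / (r ^ 2 / 2 + (M + r) ^ 2) ^ 3 * volume.real (ball (0 : ℂ) r) with hc
  set C := ∫ ζ : ℂ, ‖ζ‖ / (r ^ 2 / 2 + ‖ζ‖ ^ 2) ^ 2 with hC
  have hc0 : 0 < c := by
    have : 0 < volume.real (ball (0 : ℂ) r) :=
      ENNReal.toReal_pos (measure_ball_pos _ _ hr).ne' measure_ball_lt_top.ne
    positivity
  have hC0 : 0 ≤ C := integral_nonneg fun ζ => by positivity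
  refine ⟨32 * C ^ 2 / c ^ 2, by positivity, fun φ ⟨hφs, hφc, hφΩ⟩ => ?_⟩
  have hφ : ContDiff ℝ 2 φ := contDiff_infty.1 hφs 2
  have hmem : ∀ z, φ z ≠ 0 → z ∈ Ω := fun z hz => hφΩ (subset_tsupport _ hz)
  have key := mul_integral_norm_sq_le hφ hφc hr hM (E := {w | r ≤ infDist w (closure Ω)})
    (measurableSet_le measurable_const (measurable_infDist)) ?_ ?_
  · rw [← hc, ← hC, ← integral_const_mul, ← integral_const_mul] at key
    have cφ := hφ.continuous
    have cf := fun e => (hφ.continuous_fderiv two_ne_zero).clm_apply (continuous_const (y := e))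
    have c1 := cf 1
    have cI := cf I
    have hcd : HasCompactSupport (fderiv ℝ φ) := hφc.fderiv ℝ
    have i1 : Integrable fun z => ‖φ z‖ ^ 2 := Continuous.integrable_of_hasCompactSupport
      (by fun_prop) (hφc.mono fun z hz h => hz (by simp [h]))
    have i2 : Integrable fun z => ‖fderiv ℝ φ z 1‖ ^ 2 + ‖fderiv ℝ φ z I‖ ^ 2 :=
      Continuous.integrable_of_hasCompactSupport
      (by fun_prop) (hcd.mono fun z hz h => hz (by simp [h]))
    have hle := key.trans (integral_mono (g := fun z => c / 2 * ‖φ z‖ ^ 2 +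
      4 * C ^ 2 / c * (‖fderiv ℝ φ z 1‖ ^ 2 + ‖fderiv ℝ φ z I‖ ^ 2)) ?_ ?_ ?_)
    · rw [integral_add (i1.const_mul _) (i2.const_mul _), integral_const_mul, integral_const_mul,
        integral_const_mul, integral_norm_sq_fderiv_eq_dbar1 hφ hφc] at hle
      have h3 : c * ∫ z, ‖φ z‖ ^ 2 ≤ 32 * C ^ 2 / c * ∫ z, ‖dbar1 φ z‖ ^ 2 := by
        linear_combination 2 * hle
      rw [← le_div_iff₀' hc0] at h3
      refine h3.trans_eq ?_
      field_simp
    · refine Continuous.integrable_of_hasCompactSupport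
        (by fun_prop) (hφc.mono fun z hz h => hz (by simp [h]))
    · exact (i1.const_mul _).add (i2.const_mul _)
    · intro z
      set x := ‖φ z‖
      have amgm : ∀ y : ℝ, C * (2 * (x * y)) ≤ c / 4 * x ^ 2 + 4 * C ^ 2 / c * y ^ 2 := by
        intro y
        have : 0 ≤ (c / 2 * x - 2 * C * y) ^ 2 / c := by positivity
        have e : (c / 2 * x - 2 * C * y) ^ 2 / c =
          c / 4 * x ^ 2 + 4 * C ^ 2 / c * y ^ 2 - C * (2 * (x * y)) := by
          field_simp
          ring
        linarith
      have := add_le_add (amgm ‖fderiv ℝ φ z 1‖) (amgm ‖fderiv ℝ φ z I‖)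
      dsimp only
      linear_combination this
  · intro z hz w hw
    have := infDist_le_dist_of_mem (x := w) (subset_closure (hmem z hz))
    rw [dist_comm, dist_eq_norm] at this
    exact le_trans hw this
  · intro z hz
    obtain ⟨p, hp, -, hpδ⟩ := h z (hmem z hz)
    refine ⟨p, by rwa [dist_comm, dist_eq_norm] at hp, fun w hw => ?_⟩
    have := infDist_le_infDist_add_dist (s := closure Ω) (x := p) (y := w)
    rw [mem_ball, dist_comm] at hw
    change r ≤ _
    linarith

/-- If a functional `L` is dominated by `D`, it is represented as an inner product with `D`. -/
theorem LinearMap.exists_inner_eq_of_norm_le {T H : Type*} [AddCommGroup T] [Module ℂ T]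
    [NormedAddCommGroup H] [InnerProductSpace ℂ H] [CompleteSpace H]
    (D : T →ₗ[ℂ] H) (L : T →ₗ[ℂ] ℂ) (C : ℝ) (h : ∀ x, ‖L x‖ ≤ C * ‖D x‖) :
    ∃ v : H, ∀ x, inner ℂ v (D x) = L x := by
  have hker : LinearMap.ker D ≤ LinearMap.ker L := fun x hx => by
    have := h x
    rw [LinearMap.mem_ker.1 hx, norm_zero, mul_zero] at this
    exact norm_le_zero_iff.1 this
  let l : LinearMap.range D →ₗ[ℂ] ℂ :=
    ((LinearMap.ker D).liftQ L hker).comp D.quotKerEquivRange.symm.toLinearMap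
  have hl : ∀ x, l ⟨D x, LinearMap.mem_range_self D x⟩ = L x := fun x => by
    have : D.quotKerEquivRange.symm ⟨D x, LinearMap.mem_range_self D x⟩ =
        (LinearMap.ker D).mkQ x := D.quotKerEquivRange_symm_apply_image x _
    simp [l, this]
  obtain ⟨g, hg, -⟩ := exists_extension_norm_eq (LinearMap.range D) (l.mkContinuous C (by
    rintro ⟨_, x, rfl⟩
    rw [hl]
    exact h x))
  refine ⟨(InnerProductSpace.toDual ℂ H).symm g, fun x => ?_⟩
  rw [InnerProductSpace.toDual_symm_apply, ← hl x]
  exact hg ⟨D x, LinearMap.mem_range_self D x⟩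

/-- The space of test functions on `Ω`. -/
def testSubmodule (Ω : Set ℂ) : Submodule ℂ (ℂ → ℂ) where
  carrier := {φ | IsTest1 Ω φ}
  zero_mem' := ⟨contDiff_const, HasCompactSupport.zero, by simp [tsupport]⟩
  add_mem' := fun {φ ψ} hφ hψ => ⟨hφ.1.add hψ.1, hφ.2.1.add hψ.2.1,
    (tsupport_add φ ψ).trans (union_subset hφ.2.2 hψ.2.2)⟩
  smul_mem' := fun c φ hφ => ⟨hφ.1.const_smul c, hφ.2.1.smul_left (f := fun _ => c),
    (tsupport_smul_subset_right (fun _ => c) φ).trans hφ.2.2⟩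

theorem IsTest1.differentiable {Ω : Set ℂ} {φ : ℂ → ℂ} (h : IsTest1 Ω φ) :
    Differentiable ℝ φ := h.1.differentiable (by simp)

theorem dbar1_add {φ ψ : ℂ → ℂ} (hφ : Differentiable ℝ φ) (hψ : Differentiable ℝ ψ) :
    dbar1 (φ + ψ) = dbar1 φ + dbar1 ψ := by
  ext z
  simp only [dbar1, fderiv_add (hφ z) (hψ z), Pi.add_apply, add_apply]
  ring

theorem dbar1_smul (c : ℂ) {φ : ℂ → ℂ} (hφ : Differentiable ℝ φ) :
    dbar1 (c • φ) = c • dbar1 φ := by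
  ext z
  simp only [dbar1, fderiv_const_smul (hφ z), Pi.smul_apply, smul_apply,
    smul_eq_mul]
  ring

theorem IsTest1.continuous_dbar1 {Ω : Set ℂ} {φ : ℂ → ℂ} (h : IsTest1 Ω φ) :
    Continuous (dbar1 φ) := by
  have c := fun e => (h.1.continuous_fderiv (by simp)).clm_apply (continuous_const (y := e))
  have c1 := c 1
  have cI := c I
  unfold dbar1
  fun_prop

theorem IsTest1.dbar1_eq_zero {Ω : Set ℂ} {φ : ℂ → ℂ} (h : IsTest1 Ω φ) {z : ℂ} (hz : z ∉ Ω) :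
    dbar1 φ z = 0 := by
  have : fderiv ℝ φ z = 0 := image_eq_zero_of_notMem_tsupport
    fun h' => hz (h.2.2 (tsupport_fderiv_subset ℝ h'))
  simp [dbar1, this]

theorem IsTest1.memLp {Ω : Set ℂ} {φ : ℂ → ℂ} (h : IsTest1 Ω φ) :
    MemLp φ 2 (volume.restrict Ω) :=
  (h.1.continuous.memLp_of_hasCompactSupport h.2.1).restrict Ω

theorem IsTest1.memLp_dbar1 {Ω : Set ℂ} {φ : ℂ → ℂ} (h : IsTest1 Ω φ) :
    MemLp (dbar1 φ) 2 (volume.restrict Ω) := by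
  refine (h.continuous_dbar1.memLp_of_hasCompactSupport ?_).restrict Ω
  exact (h.2.1.fderiv ℝ).mono fun z hz h' => hz (by simp [dbar1, h'])

theorem norm_toLp_sq {μ : Measure ℂ} {g : ℂ → ℂ} (hg : MemLp g 2 μ) :
    ‖hg.toLp g‖ ^ 2 = ∫ z, ‖g z‖ ^ 2 ∂μ := by
  have h := inner_self_eq_norm_sq_to_K (𝕜 := ℂ) (hg.toLp g)
  rw [L2.inner_def] at h
  have e : ∫ a, inner ℂ (hg.toLp g a) (hg.toLp g a) ∂μ = ((∫ z, ‖g z‖ ^ 2 ∂μ : ℝ) : ℂ) := by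
    rw [← integral_complex_ofReal]
    refine integral_congr_ae ?_
    filter_upwards [hg.coeFn_toLp] with z hz
    rw [hz, inner_self_eq_norm_sq_to_K]
    simp
  rw [e] at h
  refine Complex.ofReal_injective ?_
  rw [Complex.ofReal_pow]
  exact h.symm

/-- A test-function inequality for `∂̄` yields solvability of `∂̄u = f` in `L²`. -/
theorem exists_dbarEq1_of_integral_norm_sq_le {Ω : Set ℂ} {A : ℝ} (hA : 0 ≤ A)
    (h : ∀ φ, IsTest1 Ω φ → ∫ z, ‖φ z‖ ^ 2 ≤ A * ∫ z, ‖dbar1 φ z‖ ^ 2)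
    (f : Lp ℂ 2 ((volume : Measure ℂ).restrict Ω)) :
    ∃ u : Lp ℂ 2 ((volume : Measure ℂ).restrict Ω), DbarEq1 Ω u f := by
  let J : testSubmodule Ω →ₗ[ℂ] Lp ℂ 2 ((volume : Measure ℂ).restrict Ω) :=
    { toFun := fun φ => φ.2.memLp.toLp φ
      map_add' := fun φ ψ => rfl
      map_smul' := fun c φ => rfl }
  let D : testSubmodule Ω →ₗ[ℂ] Lp ℂ 2 ((volume : Measure ℂ).restrict Ω) :=
    { toFun := fun φ => φ.2.memLp_dbar1.toLp (dbar1 φ)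
      map_add' := fun φ ψ => by
        rw [← MemLp.toLp_add]
        exact MemLp.toLp_congr _ _
          (.of_eq (dbar1_add φ.2.differentiable ψ.2.differentiable))
      map_smul' := fun c φ => by
        rw [RingHom.id_apply, ← MemLp.toLp_const_smul]
        exact MemLp.toLp_congr _ _ (.of_eq (dbar1_smul c φ.2.differentiable)) }
  have hJD : ∀ φ, ‖J φ‖ ≤ √A * ‖D φ‖ := fun φ => by
    refine le_of_sq_le_sq ?_ (by positivity)
    rw [mul_pow, Real.sq_sqrt hA]
    have e1 : ‖J φ‖ ^ 2 = ∫ z in Ω, ‖(φ : ℂ → ℂ) z‖ ^ 2 := norm_toLp_sq φ.2.memLp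
    have e2 : ‖D φ‖ ^ 2 = ∫ z in Ω, ‖dbar1 φ z‖ ^ 2 := norm_toLp_sq φ.2.memLp_dbar1
    rw [e1, e2, setIntegral_eq_integral_of_forall_compl_eq_zero,
      setIntegral_eq_integral_of_forall_compl_eq_zero]
    · exact h φ φ.2
    · intro z hz
      simp [φ.2.dbar1_eq_zero hz]
    · intro z hz
      simp [image_eq_zero_of_notMem_tsupport fun h' => hz (φ.2.2.2 h')]
  let L : testSubmodule Ω →ₗ[ℂ] ℂ := -((innerSL ℂ (star f)).toLinearMap.comp J)
  obtain ⟨v, hv⟩ := D.exists_inner_eq_of_norm_le L (‖star f‖ * √A) fun φ => by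
    rw [mul_assoc]
    calc ‖L φ‖ = ‖inner ℂ (star f) (J φ)‖ := norm_neg _
      _ ≤ ‖star f‖ * ‖J φ‖ := norm_inner_le_norm _ _
      _ ≤ _ := by gcongr; exact hJD φ
  refine ⟨star v, fun φ hφ => ?_⟩
  have hφv : inner ℂ v (D ⟨φ, hφ⟩) = -inner ℂ (star f) (J ⟨φ, hφ⟩) := hv ⟨φ, hφ⟩
  have e1 : inner ℂ v (D ⟨φ, hφ⟩) = ∫ z in Ω, (star v : Lp ℂ 2 _) z * dbar1 φ z := by
    rw [L2.inner_def]
    refine integral_congr_ae ?_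
    filter_upwards [hφ.memLp_dbar1.coeFn_toLp, Lp.coeFn_star v] with z hz hz'
    have : D ⟨φ, hφ⟩ z = dbar1 φ z := hz
    rw [this, hz', RCLike.inner_apply']
    rfl
  have e2 : inner ℂ (star f) (J ⟨φ, hφ⟩) = ∫ z in Ω, f z * φ z := by
    rw [L2.inner_def]
    refine integral_congr_ae ?_
    filter_upwards [hφ.memLp.coeFn_toLp, Lp.coeFn_star f] with z hz hz'
    have : J ⟨φ, hφ⟩ z = φ z := hz
    rw [this, hz', RCLike.inner_apply']
    simp
  rw [← e1, ← e2, hφv, neg_neg]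

/-- **Condition `𝒳` implies closed range.** Let `Ω ⊆ ℂ` be a domain satisfying
condition `𝒳`. Then `∂̄` has closed range on `L²_{0,1}(Ω)`. -/
theorem closed_range_of_condX
    (Ω : Set ℂ) (hne : Ω.Nonempty) (hop : IsOpen Ω) (hconn : IsConnected Ω)
    (hX : CondX Ω) :
    IsClosed {f : Lp ℂ 2 ((volume : Measure ℂ).restrict Ω) |
      ∃ u : Lp ℂ 2 ((volume : Measure ℂ).restrict Ω), DbarEq1 Ω (⇑u) (⇑f)} := by
  obtain ⟨A, hA, h⟩ := hX.exists_integral_norm_sq_le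
  convert isClosed_univ
  exact eq_univ_of_forall fun f =>
    exists_dbarEq1_of_integral_norm_sq_le hA h f
end
end

section
/- Let Ω ⊆ ℂ be a nonempty open connected set satisfying condition 𝒳 with constants M > 0 and δ > 0. Then there exists a set Λ ⊆ {M(a + b·i) : a, b ∈ ℤ} such that: (a) for every w ∈ Λ, the open disc D(w, M) meets both the complement of the closure of Ω and Ω itself; (b) Ω ⊆ ⋃_{w ∈ Λ} D(w, M); and (c) for every w ∈ Λ there exists w* ∈ ℂ not in the closure of Ω such that the distance from w* to the closure of Ω is greater than δ and D(w, M) ⊆ D(w*, 3M). -/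
open MeasureTheory Complex Metric Set

noncomputable section

/-- Every point of `ℂ` lies in an open disc of radius `M` about a point of `M·(ℤ + iℤ)`. -/
theorem exists_lattice_dist_lt {M : ℝ} (hM : 0 < M) (z : ℂ) :
    ∃ a b : ℤ, dist z (M * ((a : ℂ) + (b : ℂ) * Complex.I)) < M := by
  refine ⟨round (z.re / M), round (z.im / M), ?_⟩
  have key : ∀ x : ℝ, (x - M * round (x / M)) ^ 2 ≤ (M / 2) ^ 2 := by
    intro x
    have hx : x - M * round (x / M) = M * (x / M - round (x / M)) := by
      field_simp
    have h := abs_sub_round (x / M)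
    apply sq_le_sq'
    · rw [hx]
      nlinarith [(abs_le.mp h).1]
    · rw [hx]
      nlinarith [(abs_le.mp h).2]
  rw [Complex.dist_eq_re_im]
  refine (Real.sqrt_lt' hM).mpr ?_
  have h1 := key z.re
  have h2 := key z.im
  simp only [Complex.mul_re, Complex.mul_im, Complex.add_re, Complex.add_im, Complex.ofReal_re,
    Complex.ofReal_im, Complex.intCast_re, Complex.intCast_im, Complex.I_re, Complex.I_im]
  ring_nf at h1 h2 ⊢
  nlinarith [sq_pos_of_pos hM]

/-- If a ball of radius `M` lies in the closed set `S`, a point at distance less than `M + δ` from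
its centre is within `δ` of `S`. -/
theorem infDist_lt_of_ball_subset {E : Type*} [NormedAddCommGroup E] [NormedSpace ℝ E]
    {S : Set E} (hS : IsClosed S) {w p : E} {M δ : ℝ} (hM : 0 < M) (hδ : 0 < δ)
    (hsub : Metric.ball w M ⊆ S) (hp : dist p w < M + δ) : Metric.infDist p S < δ := by
  have hcl : Metric.closedBall w M ⊆ S := by
    rw [← closure_ball w hM.ne']
    exact closure_minimal hsub hS
  obtain ⟨q, hpq, hqw⟩ := exists_dist_lt_le hδ hM.le hp
  exact (Metric.infDist_le_dist_of_mem (hcl hqw)).trans_lt hpq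

/-- Under condition `𝒳`, no disc of radius `M` is contained in `closure Ω`. -/
theorem CondXWith.ball_inter_compl_closure_nonempty {Ω : Set ℂ} {M δ : ℝ} (hM : 0 < M)
    (hδ : 0 < δ) (hX : CondXWith Ω M δ) (w : ℂ) :
    (Metric.ball w M ∩ (closure Ω)ᶜ).Nonempty := by
  rw [Set.inter_compl_nonempty_iff]
  intro hsub
  obtain ⟨z, hz, hwz⟩ := Metric.mem_closure_iff.mp (hsub (Metric.mem_ball_self hM)) δ hδ
  obtain ⟨p, hpz, -, hp⟩ := hX z hz
  refine hp.not_gt (infDist_lt_of_ball_subset isClosed_closure hM hδ hsub ?_)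
  linarith [dist_triangle p z w, dist_comm z w]

/-- **Lattice lemma.** If `Ω ⊆ ℂ` is a domain satisfying condition `𝒳` with constants
`M, δ > 0`, then there is a subset `Λ` of the lattice `M·(ℤ + iℤ)` such that (a) each disc
`D(w, M)`, `w ∈ Λ`, meets both `(closure Ω)ᶜ` and `Ω`; (b) the discs `D(w, M)`, `w ∈ Λ`,
cover `Ω`; and (c) for each `w ∈ Λ` there is `w* ∉ closure Ω` with `dist(w*, closure Ω) > δ`
and `D(w, M) ⊆ D(w*, 3M)`. -/
theorem lattice_lemma
    (Ω : Set ℂ) (hne : Ω.Nonempty) (hop : IsOpen Ω) (hconn : IsConnected Ω)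
    (M δ : ℝ) (hM : 0 < M) (hδ : 0 < δ) (hX : CondXWith Ω M δ) :
    ∃ Λ : Set ℂ, Λ ⊆ {w : ℂ | ∃ a b : ℤ, w = M * ((a : ℂ) + (b : ℂ) * Complex.I)} ∧
      (∀ w ∈ Λ, (Metric.ball w M ∩ (closure Ω)ᶜ).Nonempty ∧
        (Metric.ball w M ∩ Ω).Nonempty) ∧
      Ω ⊆ (⋃ w ∈ Λ, Metric.ball w M) ∧
      (∀ w ∈ Λ, ∃ w' : ℂ, w' ∉ closure Ω ∧ δ < Metric.infDist w' (closure Ω) ∧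
        Metric.ball w M ⊆ Metric.ball w' (3 * M)) := by
  refine ⟨{w | (∃ a b : ℤ, w = M * ((a : ℂ) + (b : ℂ) * Complex.I)) ∧
    (Metric.ball w M ∩ Ω).Nonempty}, fun w hw => hw.1,
    fun w hw => ⟨hX.ball_inter_compl_closure_nonempty hM hδ w, hw.2⟩, fun z hz => ?_, ?_⟩
  · obtain ⟨a, b, h⟩ := exists_lattice_dist_lt hM z
    exact Set.mem_iUnion₂.mpr ⟨_, ⟨⟨a, b, rfl⟩, z, h, hz⟩, h⟩
  · rintro w ⟨-, z, hzw, hz⟩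
    obtain ⟨p, hpz, hp, hpδ⟩ := hX z hz
    refine ⟨p, hp, hpδ, Metric.ball_subset_ball' ?_⟩
    rw [Metric.mem_ball] at hzw
    linarith [dist_triangle w z p, dist_comm z w, dist_comm p z]
end
end

section
/- Let Ω ⊆ ℂ be a nonempty open connected set satisfying condition 𝒳. Then there exist constants A, B > 0 and a real-valued function φ, twice continuously differentiable on an open set containing the closure of Ω, such that |φ(z)| ≤ A for all z ∈ Ω and φ_{zz̄}(z) ≥ B for all z ∈ Ω, where φ_{zz̄}(z) := (1/4)(D²φ_z(1, 1) + D²φ_z(i, i)) is one quarter of the Laplacian of φ at z. -/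
open MeasureTheory Complex Metric Set

noncomputable section

/-- The truncated power `max x 0 ^ k`. -/
def posPow (k : ℕ) (x : ℝ) : ℝ := max x 0 ^ k

lemma posPow_nonneg (k : ℕ) (x : ℝ) : 0 ≤ posPow k x := pow_nonneg (le_max_right _ _) _

lemma hasDerivAt_posPow (k : ℕ) (x : ℝ) :
    HasDerivAt (posPow (k + 2)) ((k + 2) * posPow (k + 1) x) x := by
  have hpow : HasDerivAt (fun y : ℝ => y ^ (k + 2)) ((k + 2) * x ^ (k + 1)) x := by
    simpa using hasDerivAt_pow (k + 2) x
  rcases lt_trichotomy x 0 with hx | rfl | hx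
  · have h0 : (k + 2 : ℝ) * posPow (k + 1) x = 0 := by simp [posPow, hx.le]
    rw [h0]
    refine (hasDerivAt_const x (0 : ℝ)).congr_of_eventuallyEq ?_
    filter_upwards [Iio_mem_nhds hx] with y hy
    simp [posPow, le_of_lt (show y < 0 from hy)]
  · have h0 : (k + 2 : ℝ) * posPow (k + 1) 0 = 0 := by simp [posPow]
    rw [h0]
    have hl : HasDerivWithinAt (posPow (k + 2)) 0 (Iic 0) 0 :=
      (hasDerivWithinAt_const (0 : ℝ) (Iic 0) (0 : ℝ)).congr
        (fun y hy => by simp [posPow, show y ≤ 0 from hy]) (by simp [posPow])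
    have hr : HasDerivWithinAt (posPow (k + 2)) 0 (Ici 0) 0 := by
      have h := hpow.hasDerivWithinAt (s := Ici (0 : ℝ))
      simp only [ne_eq, Nat.add_eq_zero_iff, one_ne_zero, and_false, not_false_eq_true, zero_pow,
        mul_zero] at h
      exact h.congr (fun y hy => by simp [posPow, show 0 ≤ y from hy]) (by simp [posPow])
    have h := hl.union hr
    rwa [Iic_union_Ici, hasDerivWithinAt_univ] at h
  · have h0 : posPow (k + 1) x = x ^ (k + 1) := by simp [posPow, hx.le]
    rw [h0]
    refine hpow.congr_of_eventuallyEq ?_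
    filter_upwards [Ioi_mem_nhds hx] with y hy
    simp [posPow, le_of_lt (show 0 < y from hy)]

lemma continuous_posPow (k : ℕ) : Continuous (posPow k) := by
  unfold posPow; fun_prop

lemma contDiff_one_posPow (k : ℕ) : ContDiff ℝ 1 (posPow (k + 2)) := by
  rw [contDiff_one_iff_deriv]
  refine ⟨fun x => (hasDerivAt_posPow k x).differentiableAt, ?_⟩
  rw [funext fun x => (hasDerivAt_posPow k x).deriv]
  exact continuous_const.mul (continuous_posPow _)

lemma contDiff_two_posPow (k : ℕ) : ContDiff ℝ 2 (posPow (k + 3)) := by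
  rw [show (2 : WithTop ℕ∞) = 1 + 1 by norm_num, contDiff_succ_iff_deriv]
  refine ⟨fun x => (hasDerivAt_posPow (k + 1) x).differentiableAt, by simp, ?_⟩
  rw [show deriv (posPow (k + 3)) = _ from funext fun x => (hasDerivAt_posPow (k + 1) x).deriv]
  exact contDiff_const.mul (contDiff_one_posPow k)

/-- The radial profile `z ↦ max (r - |z|²) 0 ^ (n + 4)`. -/
def radialBump (n : ℕ) (r : ℝ) (z : ℂ) : ℝ := posPow (n + 4) (r - normSq z)

lemma hasFDerivAt_const_sub_normSq (r : ℝ) (z : ℂ) :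
    HasFDerivAt (fun y : ℂ => r - normSq y)
      (-((2 * z.re) • reCLM + (2 * z.im) • imCLM)) z := by
  have h1 : HasFDerivAt (fun y : ℂ => y.re) reCLM z := reCLM.hasFDerivAt
  have h2 : HasFDerivAt (fun y : ℂ => y.im) imCLM z := imCLM.hasFDerivAt
  have h := ((h1.mul h1).add (h2.mul h2)).const_sub r
  simp only [normSq_apply]
  refine h.congr_fderiv ?_
  ext v
  simp
  ring

lemma contDiff_radialBump (n : ℕ) (r : ℝ) : ContDiff ℝ 2 (radialBump n r) := by
  have h : ContDiff ℝ 2 (fun z : ℂ => r - normSq z) := by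
    simp only [normSq_apply]
    have h1 : ContDiff ℝ 2 (fun y : ℂ => y.re) := reCLM.contDiff
    have h2 : ContDiff ℝ 2 (fun y : ℂ => y.im) := imCLM.contDiff
    fun_prop
  exact (contDiff_two_posPow (n + 1)).comp h

lemma hasCompactSupport_radialBump (n : ℕ) (r : ℝ) : HasCompactSupport (radialBump n r) := by
  refine HasCompactSupport.intro (isCompact_closedBall (0 : ℂ) (r + 1)) fun z hz => ?_
  have hz : r + 1 < ‖z‖ := by simpa using hz
  have : r - normSq z ≤ 0 := by
    rw [normSq_eq_norm_sq]; nlinarith [norm_nonneg z, sq_nonneg (‖z‖ - 1)]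
  simp [radialBump, posPow, this]

lemma fderiv_radialBump (n : ℕ) (r : ℝ) (z v : ℂ) :
    fderiv ℝ (radialBump n r) z v =
      -(2 * (n + 4)) * posPow (n + 3) (r - normSq z) * (z.re * v.re + z.im * v.im) := by
  have h := (hasDerivAt_posPow (n + 2) (r - normSq z)).comp_hasFDerivAt z
    (hasFDerivAt_const_sub_normSq r z)
  rw [show radialBump n r = posPow (n + 2 + 2) ∘ fun y => r - normSq y from rfl, h.fderiv]
  simp
  ring

lemma fderiv_fderiv_radialBump (n : ℕ) (r : ℝ) (z v : ℂ) :
    fderiv ℝ (fun y => fderiv ℝ (radialBump n r) y v) z v =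
      4 * (n + 4) * (n + 3) * posPow (n + 2) (r - normSq z) * (z.re * v.re + z.im * v.im) ^ 2
        - 2 * (n + 4) * posPow (n + 3) (r - normSq z) * (v.re ^ 2 + v.im ^ 2) := by
  have h1 : HasFDerivAt (fun y : ℂ => y.re) reCLM z := reCLM.hasFDerivAt
  have h2 : HasFDerivAt (fun y : ℂ => y.im) imCLM z := imCLM.hasFDerivAt
  have h := (((hasDerivAt_posPow (n + 1) (r - normSq z)).comp_hasFDerivAt z
    (hasFDerivAt_const_sub_normSq r z)).const_mul (-(2 * (n + 4 : ℝ)))).mul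
      ((h1.mul_const v.re).add (h2.mul_const v.im))
  have e : (fun y => fderiv ℝ (radialBump n r) y v) = _ := funext fun y => fderiv_radialBump n r y v
  rw [e]
  refine (congrArg (fun T : ℂ →L[ℝ] ℝ => T v) h.fderiv).trans ?_
  simp
  ring

lemma iteratedFDeriv_two_diag {f : ℂ → ℝ} (hf : ContDiff ℝ 2 f) (z v : ℂ) :
    iteratedFDeriv ℝ 2 f z ![v, v] = fderiv ℝ (fun y => fderiv ℝ f y v) z v := by
  have hd : DifferentiableAt ℝ (fderiv ℝ f) z :=
    (hf.fderiv_right (m := 1) (by norm_num)).differentiable (by norm_num) z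
  rw [iteratedFDeriv_two_apply, fderiv_clm_apply hd (differentiableAt_const v)]
  simp

lemma lapQuarter_radialBump (n : ℕ) (r : ℝ) (z : ℂ) :
    lapQuarter (radialBump n r) z =
      (n + 4) * ((n + 3) * posPow (n + 2) (r - normSq z) * normSq z
        - posPow (n + 3) (r - normSq z)) := by
  simp only [lapQuarter, iteratedFDeriv_two_diag (contDiff_radialBump n r),
    fderiv_fderiv_radialBump, normSq_apply]
  simp
  ring

lemma le_lapQuarter_radialBump {n : ℕ} {r : ℝ} {z : ℂ} (h : r + 1 ≤ n * normSq z) :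
    posPow (n + 2) (r - normSq z) ≤ lapQuarter (radialBump n r) z := by
  rw [lapQuarter_radialBump]
  have hn : (0 : ℝ) ≤ n := n.cast_nonneg
  have hz := normSq_nonneg z
  have hP := posPow_nonneg (n + 2) (r - normSq z)
  have key : posPow (n + 2) (r - normSq z)
      ≤ (n + 3) * posPow (n + 2) (r - normSq z) * normSq z - posPow (n + 3) (r - normSq z) := by
    rcases le_total (r - normSq z) 0 with h0 | h0
    · simp [posPow, h0]
    · have e : posPow (n + 3) (r - normSq z)
          = posPow (n + 2) (r - normSq z) * (r - normSq z) := by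
        simp [posPow, h0, pow_succ]
      rw [e]
      nlinarith [mul_nonneg hP hz, mul_nonneg hP (sub_nonneg.2 h)]
  nlinarith

open scoped Convolution

lemma fderiv_convolution_apply {f g : ℂ → ℝ} (hf : LocallyIntegrable f) (hg : ContDiff ℝ 1 g)
    (hc : HasCompactSupport g) (v : ℂ) :
    (fun x => fderiv ℝ (f ⋆[ContinuousLinearMap.mul ℝ ℝ, volume] g) x v)
      = f ⋆[ContinuousLinearMap.mul ℝ ℝ, volume] (fun y => fderiv ℝ g y v) := by
  funext x
  rw [(hc.hasFDerivAt_convolution_right (ContinuousLinearMap.mul ℝ ℝ) hf hg x).fderiv]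
  exact convolution_precompR_apply (ContinuousLinearMap.mul ℝ ℝ) hf (hc.fderiv ℝ)
    (hg.continuous_fderiv (by norm_num)) x v

lemma iteratedFDeriv_two_convolution_diag {f g : ℂ → ℝ} (hf : LocallyIntegrable f)
    (hg : ContDiff ℝ 2 g) (hc : HasCompactSupport g) (z v : ℂ) :
    iteratedFDeriv ℝ 2 (f ⋆[ContinuousLinearMap.mul ℝ ℝ, volume] g) z ![v, v]
      = (f ⋆[ContinuousLinearMap.mul ℝ ℝ, volume]
          fun y => iteratedFDeriv ℝ 2 g y ![v, v]) z := by
  have hg' : ContDiff ℝ 1 (fun y => fderiv ℝ g y v) :=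
    (hg.fderiv_right (m := 1) (by norm_num)).clm_apply contDiff_const
  have hc' : HasCompactSupport (fun y => fderiv ℝ g y v) := hc.fderiv_apply ℝ v
  rw [iteratedFDeriv_two_diag (hc.contDiff_convolution_right _ hf hg),
    fderiv_convolution_apply hf (hg.of_le (by norm_num)) hc]
  simp only [iteratedFDeriv_two_diag hg]
  exact congrFun (fderiv_convolution_apply hf hg' hc' v) z

lemma hasCompactSupport_iteratedFDeriv_two_diag {g : ℂ → ℝ} (hc : HasCompactSupport g) (v : ℂ) :
    HasCompactSupport (fun y => iteratedFDeriv ℝ 2 g y ![v, v]) :=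
  (hc.iteratedFDeriv (𝕜 := ℝ) 2).comp_left
    (g := fun T : ℂ [×2]→L[ℝ] ℝ => T ![v, v]) (by simp)

lemma continuous_iteratedFDeriv_two_diag {g : ℂ → ℝ} (hg : ContDiff ℝ 2 g) (v : ℂ) :
    Continuous (fun y => iteratedFDeriv ℝ 2 g y ![v, v]) :=
  (continuous_eval_const _).comp (hg.continuous_iteratedFDeriv le_rfl)

lemma hasCompactSupport_lapQuarter {g : ℂ → ℝ} (hc : HasCompactSupport g) :
    HasCompactSupport (lapQuarter g) :=
  ((hasCompactSupport_iteratedFDeriv_two_diag hc 1).add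
    (hasCompactSupport_iteratedFDeriv_two_diag hc I)).mul_left (f := fun _ => 1 / 4)

lemma continuous_lapQuarter {g : ℂ → ℝ} (hg : ContDiff ℝ 2 g) :
    Continuous (lapQuarter g) :=
  continuous_const.mul ((continuous_iteratedFDeriv_two_diag hg 1).add
    (continuous_iteratedFDeriv_two_diag hg I))

lemma lapQuarter_convolution {f g : ℂ → ℝ} (hf : LocallyIntegrable f)
    (hg : ContDiff ℝ 2 g) (hc : HasCompactSupport g) (z : ℂ) :
    lapQuarter (f ⋆[ContinuousLinearMap.mul ℝ ℝ, volume] g) z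
      = ∫ t, f t * lapQuarter g (z - t) := by
  have hint (v : ℂ) : Integrable fun t => f t * iteratedFDeriv ℝ 2 g (z - t) ![v, v] :=
    (hasCompactSupport_iteratedFDeriv_two_diag hc v).convolutionExists_right (ContinuousLinearMap.mul ℝ ℝ) hf
      (continuous_iteratedFDeriv_two_diag hg v) z
  simp only [lapQuarter, iteratedFDeriv_two_convolution_diag hf hg hc, convolution_def,
    ContinuousLinearMap.mul_apply']
  rw [← integral_add (hint _) (hint _), ← integral_const_mul]
  congr 1 with t
  ring

/-- **Construction of a bounded strictly subharmonic weight.** If `Ω ⊆ ℂ` is a domain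
satisfying condition `𝒳`, then there are constants `A, B > 0` and a real-valued function
`φ`, twice continuously differentiable on an open set containing `closure Ω`, with
`|φ| ≤ A` and `φ_{zz̄} ≥ B` on `Ω`. -/
theorem bounded_weight_of_condX
    (Ω : Set ℂ) (hne : Ω.Nonempty) (hop : IsOpen Ω) (hconn : IsConnected Ω)
    (hX : CondX Ω) :
    ∃ A > 0, ∃ B > 0, ∃ φ : ℂ → ℝ, ∃ U : Set ℂ,
      IsOpen U ∧ closure Ω ⊆ U ∧ ContDiffOn ℝ 2 φ U ∧
      (∀ z ∈ Ω, |φ z| ≤ A) ∧ (∀ z ∈ Ω, B ≤ lapQuarter φ z) := by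
  obtain ⟨M, hM, δ, hδ, hX⟩ := hX
  obtain ⟨n, hn⟩ := exists_nat_gt ((4 * M ^ 2 + 1) / (δ / 2) ^ 2)
  rw [div_lt_iff₀ (by positivity)] at hn
  set g := radialBump n (4 * M ^ 2)
  have hg : ContDiff ℝ 2 g := contDiff_radialBump _ _
  have hc : HasCompactSupport g := hasCompactSupport_radialBump _ _
  have hg0 (z : ℂ) : 0 ≤ g z := posPow_nonneg _ _
  have hgi : Integrable g := hg.continuous.integrable_of_hasCompactSupport hc
  set E : Set ℂ := {t | δ / 2 < infDist t (closure Ω)}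
  have hEm : MeasurableSet E := (isOpen_lt continuous_const (continuous_infDist_pt _)).measurableSet
  set f : ℂ → ℝ := E.indicator 1 with hf_def
  have hf : LocallyIntegrable f := (locallyIntegrable_const (1 : ℝ)).indicator hEm
  have hf0 (t : ℂ) : 0 ≤ f t := indicator_nonneg (fun _ _ => zero_le_one) t
  have hf1 (t : ℂ) : f t ≤ 1 := indicator_le_self' (fun _ _ => zero_le_one) t
  set b : ℝ := (M ^ 2) ^ (n + 2)
  have hb : 0 < b := by positivity
  have hvol (w : ℂ) : volume.real (ball w (δ / 2)) = volume.real (ball (0 : ℂ) (δ / 2)) := by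
    simp [Measure.real, Measure.addHaar_ball_center]
  refine ⟨(∫ t, g t) + 1, add_pos_of_nonneg_of_pos (integral_nonneg hg0) one_pos,
    volume.real (ball (0 : ℂ) (δ / 2)) * b,
    mul_pos (ENNReal.toReal_pos (measure_ball_pos _ _ (by positivity)).ne'
      measure_ball_lt_top.ne) hb,
    f ⋆[ContinuousLinearMap.mul ℝ ℝ, volume] g, univ, isOpen_univ, subset_univ _,
    (hc.contDiff_convolution_right _ hf hg).contDiffOn, fun z _ => ?_, fun z hz => ?_⟩
  · have hnn : 0 ≤ (f ⋆[ContinuousLinearMap.mul ℝ ℝ, volume] g) z :=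
      integral_nonneg fun t => mul_nonneg (hf0 t) (hg0 _)
    rw [abs_of_nonneg hnn, ← integral_sub_left_eq_self g volume z]
    have : (f ⋆[ContinuousLinearMap.mul ℝ ℝ, volume] g) z ≤ ∫ t, g (z - t) :=
      integral_mono (hc.convolutionExists_right _ hf hg.continuous z) (hgi.comp_sub_left z)
        fun t => mul_le_of_le_one_left (hg0 _) (hf1 t)
    linarith
  · obtain ⟨w, hwM, -, hwδ⟩ := hX z hz
    have hzc : z ∈ closure Ω := subset_closure hz
    have hδM : δ < M := (hwδ.trans_le (infDist_le_dist_of_mem hzc)).trans hwM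
    have hle (t : ℂ) (ht : t ∈ E) : posPow (n + 2) (4 * M ^ 2 - normSq (z - t))
        ≤ lapQuarter g (z - t) := by
      refine le_lapQuarter_radialBump (hn.le.trans ?_)
      have h1 : δ / 2 < ‖z - t‖ := by
        rw [← dist_eq_norm, dist_comm]
        exact lt_of_lt_of_le ht (infDist_le_dist_of_mem hzc)
      rw [normSq_eq_norm_sq]
      gcongr
    rw [lapQuarter_convolution hf hg hc]
    have hint : Integrable fun t => f t * lapQuarter g (z - t) :=
      (hasCompactSupport_lapQuarter hc).convolutionExists_right (ContinuousLinearMap.mul ℝ ℝ) hf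
        (continuous_lapQuarter hg) z
    have hind : ∫ t, (ball w (δ / 2)).indicator (fun _ => b) t
        = volume.real (ball (0 : ℂ) (δ / 2)) * b := by
      rw [integral_indicator measurableSet_ball, setIntegral_const, hvol, smul_eq_mul]
    rw [← hind]
    refine integral_mono ((integrable_indicator_iff measurableSet_ball).2
      (integrableOn_const measure_ball_lt_top.ne)) hint fun t => ?_
    by_cases htE : t ∈ E
    · have hft : f t = 1 := by simp [hf_def, htE]
      simp only [hft, one_mul]
      refine le_trans ?_ (hle t htE)
      by_cases htb : t ∈ ball w (δ / 2)
      · rw [indicator_of_mem htb]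
        have h2 : ‖z - t‖ ≤ 3 / 2 * M := by
          rw [← dist_eq_norm]
          have := dist_triangle_right z t w
          rw [dist_comm z w] at this
          have := mem_ball.1 htb
          linarith
        refine pow_le_pow_left₀ (by positivity) (le_max_of_le_left ?_) _
        rw [normSq_eq_norm_sq]
        nlinarith [norm_nonneg (z - t)]
      · rw [indicator_of_notMem htb]
        exact posPow_nonneg _ _
    · have htb : t ∉ ball w (δ / 2) := fun htb => htE <| by
        have := infDist_le_infDist_add_dist (s := closure Ω) (x := w) (y := t)
        rw [mem_ball, dist_comm] at htb
        show δ / 2 < _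
        linarith
      simp [hf_def, htE, htb]
end
end

section
/- Let (c_j)_{j ∈ ℤ} be a strictly increasing sequence of real numbers with c_j → +∞ as j → +∞ and c_j → −∞ as j → −∞, and suppose there is M > 0 with c_j − c_{j−1} ≤ M for all j ∈ ℤ. Let (η_j)_{j ∈ ℤ} be smooth functions ℝ → ℝ satisfying, for all x ∈ ℝ and j ∈ ℤ: η_{2j}(x) < c_j < η_{2j+1}(x) and η_{2j−1}(x) < η_{2j}(x). Define S_j := {z ∈ ℂ : η_{2j−1}(Re z) < Im z < η_{2j}(Re z)} and S := ⋃_{j ∈ ℤ} S_j. Then there exist a twice continuously differentiable function φ : ℂ → ℝ and constants A, B > 0 such that |φ(z)| ≤ A and φ_{zz̄}(z) ≥ B for all z ∈ S. -/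
open MeasureTheory Complex Metric Set

noncomputable section

open scoped Manifold ContDiff Topology

lemma hasFDerivAt_im_sub_sq (a : ℝ) (z : ℂ) :
    HasFDerivAt (fun w : ℂ ↦ (w.im - a) ^ 2) ((2 * (z.im - a)) • Complex.imCLM) z := by
  have h : HasFDerivAt (fun w : ℂ ↦ w.im - a) Complex.imCLM z :=
    Complex.imCLM.hasFDerivAt.sub_const a
  simpa using h.pow 2

lemma lapQuarter_im_sub_sq (a : ℝ) (z : ℂ) :
    lapQuarter (fun w : ℂ ↦ (w.im - a) ^ 2) z = 1 / 2 := by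
  have hfirst : fderiv ℝ (fun w : ℂ ↦ (w.im - a) ^ 2) =
      fun w ↦ (2 * (w.im - a)) • Complex.imCLM :=
    funext fun w ↦ (hasFDerivAt_im_sub_sq a w).fderiv
  have hcoeff : HasFDerivAt (fun w : ℂ ↦ 2 * (w.im - a)) ((2 : ℝ) • Complex.imCLM) z :=
    (Complex.imCLM.hasFDerivAt.sub_const a).const_mul 2
  have hsecond := (hcoeff.smul_const Complex.imCLM).fderiv
  simp only [lapQuarter, iteratedFDeriv_two_apply, hfirst, hsecond]
  norm_num

lemma lapQuarter_congr {φ ψ : ℂ → ℝ} {z : ℂ} (h : φ =ᶠ[𝓝 z] ψ) :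
    lapQuarter φ z = lapQuarter ψ z := by
  simp only [lapQuarter, (h.iteratedFDeriv ℝ 2).eq_of_nhds]

/-- A strictly increasing, two-sided unbounded sequence splits the line into half-open
intervals. -/
lemma exists_le_lt_add_one_of_tendsto {c : ℤ → ℝ} (hmono : StrictMono c)
    (htop : Filter.Tendsto c Filter.atTop Filter.atTop)
    (hbot : Filter.Tendsto c Filter.atBot Filter.atBot) (y : ℝ) :
    ∃ j : ℤ, c j ≤ y ∧ y < c (j + 1) := by
  obtain ⟨b, hb⟩ := (htop.eventually_gt_atTop y).exists
  obtain ⟨j, hj, hmax⟩ := Int.exists_greatest_of_bdd (P := fun j ↦ c j ≤ y)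
    ⟨b, fun k hk ↦ (hmono.lt_iff_lt.1 (hk.trans_lt hb)).le⟩
    (hbot.eventually_le_atBot y).exists
  refine ⟨j, hj, lt_of_not_ge fun h ↦ ?_⟩
  have := hmax _ h
  omega

/-- **Weight on a union of strips.** Let `(c_j)_{j∈ℤ}` be strictly increasing with
`c_j → ±∞` and gaps `c_j − c_{j−1} ≤ M`, and let `η_j : ℝ → ℝ` be smooth with
`η_{2j}(x) < c_j < η_{2j+1}(x)` and `η_{2j−1}(x) < η_{2j}(x)` for all `x`. Then on
`S = ⋃_j {η_{2j−1}(Re z) < Im z < η_{2j}(Re z)}` there is a `C²` function `φ : ℂ → ℝ` and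
constants `A, B > 0` with `|φ| ≤ A` and `φ_{zz̄} ≥ B` on `S`. -/
theorem strip_weight
    (c : ℤ → ℝ) (hmono : StrictMono c)
    (htop : Filter.Tendsto c Filter.atTop Filter.atTop)
    (hbot : Filter.Tendsto c Filter.atBot Filter.atBot)
    (M : ℝ) (hM : 0 < M) (hgap : ∀ j : ℤ, c j - c (j - 1) ≤ M)
    (η : ℤ → ℝ → ℝ) (hη : ∀ j : ℤ, ContDiff ℝ (⊤ : ℕ∞) (η j))
    (h1 : ∀ (j : ℤ) (x : ℝ), η (2 * j) x < c j)
    (h2 : ∀ (j : ℤ) (x : ℝ), c j < η (2 * j + 1) x)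
    (h3 : ∀ (j : ℤ) (x : ℝ), η (2 * j - 1) x < η (2 * j) x) :
    ∃ φ : ℂ → ℝ, ContDiff ℝ 2 φ ∧ ∃ A > 0, ∃ B > 0,
      ∀ z ∈ ⋃ j : ℤ, {z : ℂ | η (2 * j - 1) z.re < z.im ∧ z.im < η (2 * j) z.re},
        |φ z| ≤ A ∧ B ≤ lapQuarter φ z := by
  let S : ℤ → Set ℂ :=
    fun j ↦ {z : ℂ | η (2 * j - 1) z.re < z.im ∧ z.im < η (2 * j) z.re}
  have hcont : ∀ j, Continuous fun z : ℂ ↦ η j z.re :=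
    fun j ↦ (hη j).continuous.comp Complex.continuous_re
  have hSopen : ∀ j, IsOpen (S j) := fun j ↦
    (isOpen_lt (hcont _) Complex.continuous_im).inter (isOpen_lt Complex.continuous_im (hcont _))
  have hlow : ∀ (j : ℤ) (x : ℝ), c (j - 1) < η (2 * j - 1) x := fun j x ↦ by
    have := h2 (j - 1) x
    rwa [show 2 * (j - 1) + 1 = 2 * j - 1 by ring] at this
  have hSim : ∀ j, ∀ z ∈ S j, c (j - 1) < z.im ∧ z.im < c j := fun j z hz ↦
    ⟨(hlow j z.re).trans hz.1, hz.2.trans (h1 j z.re)⟩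
  have hindex : ∀ {j k : ℤ} {y : ℝ}, c (j - 1) < y → y < c k → j ≤ k := fun hj hk ↦ by
    have := hmono.lt_iff_lt.1 (hj.trans hk)
    omega
  let t : ℂ → Set ℝ := fun z ↦ {v | ∀ j, z ∈ S j → v = (z.im - c j) ^ 2}
  have ht : ∀ z, Convex ℝ (t z) := by
    intro z u hu v hv a b _ _ hab j hj
    rw [hu j hj, hv j hj, ← add_smul, hab, one_smul]
  have hloc : ∀ z : ℂ, ∃ U ∈ 𝓝 z, ∃ g : ℂ → ℝ,
      ContMDiffOn 𝓘(ℝ, ℂ) 𝓘(ℝ, ℝ) 2 g U ∧ ∀ w ∈ U, g w ∈ t w := by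
    intro z
    obtain ⟨j, hj, hj'⟩ := exists_le_lt_add_one_of_tendsto hmono htop hbot z.im
    rcases hj.eq_or_lt with hj | hj
    · refine ⟨{w | η (2 * j) w.re < w.im ∧ w.im < η (2 * j + 1) w.re},
        ((isOpen_lt (hcont _) Complex.continuous_im).inter
          (isOpen_lt Complex.continuous_im (hcont _))).mem_nhds
          ⟨(h1 j z.re).trans_eq hj, hj.symm.trans_lt (h2 j z.re)⟩,
        fun _ ↦ 0, contMDiffOn_const, fun w hw k hk ↦ ?_⟩
      exfalso
      have hlo : c (j - 1) < w.im :=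
        ((hlow j w.re).trans (h3 j w.re)).trans hw.1
      have hhi : w.im < c (j + 1) := by
        have h := h3 (j + 1) w.re
        rw [show 2 * (j + 1) - 1 = 2 * j + 1 by ring] at h
        exact hw.2.trans (h.trans (h1 (j + 1) w.re))
      have hjk := hindex hlo (hSim k w hk).2
      have hkj := hindex (hSim k w hk).1 hhi
      obtain rfl | rfl : k = j ∨ k = j + 1 := by omega
      · exact lt_asymm hw.1 hk.2
      · have h := hk.1
        rw [show 2 * (j + 1) - 1 = 2 * j + 1 by ring] at h
        exact lt_asymm hw.2 h
    · refine ⟨{w | c j < w.im ∧ w.im < c (j + 1)},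
        ((isOpen_lt continuous_const Complex.continuous_im).inter
          (isOpen_lt Complex.continuous_im continuous_const)).mem_nhds ⟨hj, hj'⟩,
        fun w ↦ (w.im - c (j + 1)) ^ 2, ?_, fun w hw k hk ↦ ?_⟩
      · exact ((Complex.imCLM.contDiff.sub contDiff_const).pow 2).contMDiff.contMDiffOn
      · have hw' : c (j + 1 - 1) < w.im := by simpa using hw.1
        rw [le_antisymm (hindex hw' (hSim k w hk).2) (hindex (hSim k w hk).1 hw.2)]
  obtain ⟨φ, hφ⟩ := exists_contMDiffMap_forall_mem_convex_of_local 𝓘(ℝ, ℂ) ht hloc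
  refine ⟨φ, φ.contMDiff.contDiff, M ^ 2, by positivity, 1 / 2, by norm_num, fun z hz ↦ ?_⟩
  obtain ⟨j, hj⟩ := mem_iUnion.1 hz
  constructor
  · have := hSim j z hj
    have := hgap j
    rw [hφ z j hj, abs_of_nonneg (sq_nonneg _)]
    exact sq_le_sq' (by linarith) (by linarith)
  · have heq : φ =ᶠ[𝓝 z] fun w ↦ (w.im - c j) ^ 2 :=
      Filter.eventually_of_mem ((hSopen j).mem_nhds hj) fun w hw ↦ hφ w j hw
    rw [lapQuarter_congr heq, lapQuarter_im_sub_sq]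
end
end
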